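/- arXiv:1801.08195 — 4 statements merged into one kernel-verified Lean document; each statement's English description precedes it below -/
import Mathlib

section
/- Suppose the link L = (f1, f2) : f3 contains a linear form. Then pd(R/I) ≤ 3. -/
open MvPolynomial Filter CategoryTheory

noncomputable section

/-- The height of an ideal `J`: the infimum of the heights of the prime ideals containing it. -/
def idealHeight {R : Type} [CommRing R] (J : Ideal R) : ℕ∞ :=
  ⨅ p ∈ {p : {q : Ideal R // q.IsPrime} | J ≤ p.1}, Order.height p

/-- `pdQuotLE J n` holds iff `R ⧸ J` admits a projective resolution of length at most `n`,
i.e. the projective dimension of `R ⧸ J` as an `R`-module is at most `n`. -/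
def pdQuotLE {R : Type} [CommRing R] (J : Ideal R) (n : ℕ) : Prop :=
  ∃ P : ProjectiveResolution (ModuleCat.of R (R ⧸ J)),
    ∀ i, n < i → Limits.IsZero (P.complex.X i)

/-- The `p`-primary component of `J` for `p` a minimal prime of `J`:
the saturation of `J` at `p`. -/
def primaryComponent {R : Type} [CommRing R] (J p : Ideal R) : Ideal R :=
  ⨆ (s : R) (_ : s ∉ p), Submodule.colon J (Ideal.span {s})

/-- The unmixed part `J^un` of `J`: the intersection of the primary components of `J`
corresponding to the minimal primes of `J` of minimal height. -/
def unmixedPart {R : Type} [CommRing R] (J : Ideal R) : Ideal R :=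
  ⨅ p ∈ {p : Ideal R | p.IsPrime ∧ J ≤ p ∧ idealHeight p = idealHeight J},
    primaryComponent J p

/-- A linear prime: a prime ideal generated by forms of degree one. -/
def IsLinearPrime {k : Type} [CommSemiring k] {N : ℕ} (p : Ideal (MvPolynomial (Fin N) k)) : Prop :=
  p.IsPrime ∧ ∃ S : Set (MvPolynomial (Fin N) k), (∀ ℓ ∈ S, ℓ.IsHomogeneous 1) ∧ p = Ideal.span S

/-- A homogeneous ideal: an ideal generated by homogeneous elements. -/
def IsHomogeneousIdeal {k : Type} [CommSemiring k] {N : ℕ}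
    (J : Ideal (MvPolynomial (Fin N) k)) : Prop :=
  ∃ S : Set (MvPolynomial (Fin N) k), (∀ g ∈ S, ∃ d, g.IsHomogeneous d) ∧ J = Ideal.span S

/-- `[B]_n`: the ideal generated by all forms of degree `n` belonging to `B`. -/
def degreePart {k : Type} [CommSemiring k] {N : ℕ} (B : Ideal (MvPolynomial (Fin N) k)) (n : ℕ) :
    Ideal (MvPolynomial (Fin N) k) :=
  Ideal.span {f | f ∈ B ∧ f.IsHomogeneous n}

/-- The Hilbert–Samuel function of `R/J` with respect to the irrelevant maximal ideal:
`n ↦ length (R / (J + 𝔪^n)) = dim_k (R / (J + 𝔪^n))`. -/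
def hilbertSamuelFn {k : Type} [Field k] {N : ℕ} (J : Ideal (MvPolynomial (Fin N) k))
    (n : ℕ) : ℕ :=
  Module.finrank k
    (MvPolynomial (Fin N) k ⧸
      (J ⊔ (Ideal.span (Set.range (MvPolynomial.X : Fin N → MvPolynomial (Fin N) k))) ^ n))

/-- `HasMultiplicity J d e`: the quotient `R/J` has Krull dimension `d` and Hilbert–Samuel
multiplicity `e`, expressed through the asymptotics `d! · HS_J(n) / n^d → e` of the
Hilbert–Samuel function. -/
def HasMultiplicity {k : Type} [Field k] {N : ℕ} (J : Ideal (MvPolynomial (Fin N) k))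
    (d e : ℕ) : Prop :=
  Tendsto (fun n : ℕ => (Nat.factorial d : ℝ) * (hilbertSamuelFn J n : ℝ) / (n : ℝ) ^ d)
    atTop (nhds (e : ℝ))

/-- An ideal of `R` is extended from a subalgebra `A` if it is generated by elements of `A`. -/
def extendedFrom {k R : Type} [CommRing k] [CommRing R] [Algebra k R]
    (K : Ideal R) (A : Subalgebra k R) : Prop :=
  ∃ S : Set R, S ⊆ (A : Set R) ∧ K = Ideal.span S

universe u v

theorem aug_exact {C : Type u} [Category.{v} C] [Abelian C]
    (K : ChainComplex C ℕ) {X : C} (f : K.X 0 ⟶ X) (w : K.d 1 0 ≫ f = 0)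
    (h0 : (ShortComplex.mk _ _ w).Exact) (h : ∀ n, K.ExactAt (n+1)) (n : ℕ) :
    (K.augment f w).ExactAt (n+1) := by
  rw [HomologicalComplex.exactAt_iff' _ (n + 1 + 1) (n + 1) n (by simp) (by simp)]
  cases n with
  | zero => exact h0
  | succ n =>
    have := h n
    rw [HomologicalComplex.exactAt_iff' _ (n + 1 + 1) (n + 1) n (by simp) (by simp)] at this
    exact this

theorem exists_res {C : Type u} [Category.{v} C] [Abelian C] [EnoughProjectives C] (n : ℕ) :
    ∀ X : C, HasProjectiveDimensionLE X n →
    ∃ P : ProjectiveResolution X, ∀ i, n < i → Limits.IsZero (P.complex.X i) := by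
  induction n with
  | zero =>
    intro X hX
    have : Projective X := (projective_iff_hasProjectiveDimensionLE_zero X).2 hX
    refine ⟨ProjectiveResolution.self X, fun i hi => ?_⟩
    exact HomologicalComplex.isZero_single_obj_X _ _ _ _ (by omega)
  | succ n ih =>
    intro X hX
    let S := ShortComplex.mk (Limits.kernel.ι (Projective.π X)) (Projective.π X) (by simp)
    have hS : S.ShortExact :=
      { exact := ShortComplex.exact_of_f_is_kernel _ (Limits.kernelIsKernel _)
        mono_f := by dsimp [S]; infer_instance
        epi_g := by dsimp [S]; infer_instance }
    have hK : HasProjectiveDimensionLE S.X₁ n :=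
      (hS.hasProjectiveDimensionLT_X₃_iff n (Projective.projective_over X)).1 hX
    obtain ⟨P, hP⟩ := ih S.X₁ hK
    let g : P.complex.X 0 ⟶ S.X₁ := P.π.f 0
    have hg : Epi g := inferInstanceAs (Epi (P.π.f 0))
    have hg0 : P.complex.d 1 0 ≫ g = 0 := P.complex_d_comp_π_f_zero
    have w : P.complex.d 1 0 ≫ (g ≫ S.f) = 0 := by
      rw [← Category.assoc, hg0, Limits.zero_comp]
    have hgS : (g ≫ S.f) ≫ S.g = 0 := by rw [Category.assoc, S.zero, Limits.comp_zero]
    have ex0 : (ShortComplex.mk _ _ w).Exact := by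
      have := hS.mono_f
      let α : ShortComplex.mk _ _ hg0 ⟶ ShortComplex.mk _ _ w :=
        { τ₁ := 𝟙 _, τ₂ := 𝟙 _, τ₃ := S.f }
      have : Epi α.τ₁ := inferInstanceAs (Epi (𝟙 _))
      have : IsIso α.τ₂ := inferInstanceAs (IsIso (𝟙 _))
      have : Mono α.τ₃ := inferInstanceAs (Mono S.f)
      exact (ShortComplex.exact_iff_of_epi_of_isIso_of_mono α).1 P.exact₀
    have ex1 : (ShortComplex.mk _ _ hgS).Exact := by
      let α : ShortComplex.mk _ _ hgS ⟶ S :=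
        { τ₁ := g, τ₂ := 𝟙 _, τ₃ := 𝟙 _ }
      have : Epi α.τ₁ := hg
      have : IsIso α.τ₂ := inferInstanceAs (IsIso (𝟙 _))
      have : Mono α.τ₃ := inferInstanceAs (Mono (𝟙 _))
      exact (ShortComplex.exact_iff_of_epi_of_isIso_of_mono α).2 hS.exact
    let K := P.complex.augment (g ≫ S.f) w
    refine ⟨{ complex := K
              projective := ?_
              π := (ChainComplex.toSingle₀Equiv _ _).symm ⟨S.g, hgS⟩
              quasiIso := ⟨fun i => ?_⟩ }, ?_⟩
    · rintro (_ | i)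
      · exact Projective.projective_over X
      · exact P.projective i
    · cases i with
      | zero =>
        rw [ChainComplex.quasiIsoAt₀_iff, ShortComplex.quasiIso_iff_of_zeros']
        · refine (ShortComplex.exact_and_epi_g_iff_of_iso ?_).2 ⟨ex1, hS.epi_g⟩
          exact ShortComplex.isoMk (Iso.refl _) (Iso.refl _) (Iso.refl _)
            ((Category.id_comp _).trans (Category.comp_id _).symm)
            ((Category.id_comp _).trans (Eq.trans
              (ChainComplex.toSingle₀Equiv_symm_apply_f_zero (C := K) S.g hgS).symm
              (Category.comp_id _).symm))
        all_goals rfl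
      | succ i =>
        rw [quasiIsoAt_iff_exactAt']
        · exact aug_exact _ _ _ ex0 P.complex_exactAt_succ i
        · apply ChainComplex.exactAt_succ_single_obj
    · rintro (_ | i) hi
      · omega
      · exact hP i (by omega)

abbrev pdq {R : Type} [CommRing R] (J : Ideal R) (n : ℕ) : Prop :=
  HasProjectiveDimensionLT (ModuleCat.of R (R ⧸ J)) n

/-- `0 → R/(J : x) → R/J → R/(J + x) → 0`. -/
theorem ses {R : Type} [CommRing R] (J K L : Ideal R) (x : R)
    (hK : ∀ y, y ∈ K ↔ x * y ∈ J) (hL : L = J ⊔ Ideal.span {x}) :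
    ∃ S : ShortComplex (ModuleCat.{0} R), S.ShortExact ∧ S.X₁ = ModuleCat.of R (R ⧸ K) ∧
      S.X₂ = ModuleCat.of R (R ⧸ J) ∧ S.X₃ = ModuleCat.of R (R ⧸ L) := by
  let f : (R ⧸ K) →ₗ[R] (R ⧸ J) := Submodule.mapQ K J (LinearMap.mulLeft R x)
    (fun y hy => (hK y).1 hy)
  have hJL : J ≤ L := hL ▸ le_sup_left
  let g : (R ⧸ J) →ₗ[R] (R ⧸ L) := Submodule.mapQ J L LinearMap.id hJL
  have hfg : Function.Exact f g := by
    intro y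
    obtain ⟨y, rfl⟩ := Submodule.mkQ_surjective _ y
    constructor
    · intro h
      have h : y ∈ L := (Submodule.Quotient.mk_eq_zero L).1 h
      rw [hL, Submodule.mem_sup] at h
      obtain ⟨j, hj, z, hz, rfl⟩ := h
      obtain ⟨z, rfl⟩ := Ideal.mem_span_singleton'.1 hz
      refine ⟨Submodule.mkQ _ z, ?_⟩
      refine (Submodule.Quotient.eq J).2 ?_
      have : LinearMap.mulLeft R x z - (j + z * x) = -j := by
        simp; ring
      rw [this]
      exact J.neg_mem hj
    · rintro ⟨z, hz⟩
      obtain ⟨z, rfl⟩ := Submodule.mkQ_surjective _ z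
      rw [← hz]
      refine (Submodule.Quotient.mk_eq_zero L).2 ?_
      rw [hL]
      exact Ideal.mul_mem_right _ _ (Submodule.mem_sup_right (Ideal.mem_span_singleton_self x))
  have hf : Function.Injective f := by
    rw [injective_iff_map_eq_zero]
    intro y hy
    obtain ⟨y, rfl⟩ := Submodule.mkQ_surjective _ y
    exact (Submodule.Quotient.mk_eq_zero K).2 ((hK y).2 ((Submodule.Quotient.mk_eq_zero J).1 hy))
  have hg : Function.Surjective g := by
    intro y
    obtain ⟨y, rfl⟩ := Submodule.mkQ_surjective _ y
    exact ⟨Submodule.mkQ _ y, rfl⟩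
  refine ⟨ShortComplex.mk (ModuleCat.ofHom f) (ModuleCat.ofHom g) ?_, ?_, rfl, rfl, rfl⟩
  · ext1
    exact hfg.linearMap_comp_eq_zero
  · exact ModuleCat.shortComplex_shortExact _ hfg hf hg

theorem pdq_quot {R : Type} [CommRing R] (J K L : Ideal R) (x : R) (n : ℕ)
    (hK : ∀ y, y ∈ K ↔ x * y ∈ J) (hL : L = J ⊔ Ideal.span {x})
    (h1 : pdq K n) (h2 : pdq J (n+1)) : pdq L (n+1) := by
  obtain ⟨S, hS, e1, e2, e3⟩ := ses J K L x hK hL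
  unfold pdq at *
  rw [← e1] at h1
  rw [← e2] at h2
  rw [← e3]
  exact hS.hasProjectiveDimensionLT_X₃ n h1 h2

theorem pdq_mid {R : Type} [CommRing R] (J K L : Ideal R) (x : R) (n : ℕ)
    (hK : ∀ y, y ∈ K ↔ x * y ∈ J) (hL : L = J ⊔ Ideal.span {x})
    (h1 : pdq K n) (h3 : pdq L n) : pdq J n := by
  obtain ⟨S, hS, e1, e2, e3⟩ := ses J K L x hK hL
  unfold pdq at *
  rw [← e1] at h1
  rw [← e3] at h3
  rw [← e2]
  exact hS.hasProjectiveDimensionLT_X₂ n h1 h3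

theorem pdq_mono {R : Type} [CommRing R] {J : Ideal R} {m n : ℕ} (hmn : m ≤ n)
    (h : pdq J m) : pdq J n :=
  hasProjectiveDimensionLT_of_ge _ m n hmn

theorem pdq_bot {R : Type} [CommRing R] : pdq (⊥ : Ideal R) 1 := by
  have : Projective (ModuleCat.of R (R ⧸ (⊥ : Ideal R))) := by
    have : Module.Projective R (R ⧸ (⊥ : Ideal R)) :=
      Module.Projective.of_equiv (Submodule.quotEquivOfEqBot ⊥ rfl).symm
    exact (IsProjective.iff_projective _).1 this
  unfold pdq
  infer_instance

/-- If `x` is a nonzerodivisor modulo `J`. -/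
theorem pdq_reg {R : Type} [CommRing R] (J : Ideal R) (x : R) (n : ℕ)
    (hx : ∀ y, x * y ∈ J → y ∈ J) (h : pdq J n) : pdq (J ⊔ Ideal.span {x}) (n+1) :=
  pdq_quot J J _ x n (fun y => ⟨fun hy => J.mul_mem_left _ hy, hx y⟩) rfl h
    (pdq_mono (Nat.le_succ n) h)

theorem pdq_one {R : Type} [CommRing R] [IsDomain R] (x : R) (hx : x ≠ 0) :
    pdq (Ideal.span {x}) 2 := by
  have := pdq_reg (⊥ : Ideal R) x 1 (fun y hy => by simpa [hx] using hy) pdq_bot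
  rwa [bot_sup_eq] at this

theorem pair_eq {R : Type} [CommRing R] (x y : R) :
    Ideal.span {x, y} = Ideal.span {x} ⊔ Ideal.span {y} := Ideal.span_insert _ _

theorem pdq_two {R : Type} [CommRing R] [IsDomain R] [UniqueFactorizationMonoid R]
    (x y : R) (hx : x ≠ 0) (h : IsRelPrime x y) :
    pdq (Ideal.span {x, y}) 3 := by
  rw [pair_eq]
  refine pdq_reg _ y 2 (fun z hz => ?_) (pdq_one x hx)
  rw [Ideal.mem_span_singleton] at *
  exact h.dvd_of_dvd_mul_left hz

theorem relPrime_of_height {R : Type} [CommRing R] [IsDomain R] [UniqueFactorizationMonoid R]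
    [IsNoetherianRing R] (x y : R) (h : idealHeight (Ideal.span {x, y}) = 2) :
    IsRelPrime x y := by
  have key : ∀ p : Ideal R, p.IsPrime → Ideal.span {x, y} ≤ p → 2 ≤ p.height := by
    intro p hp hle
    let e : {q : Ideal R // q.IsPrime} ≃o PrimeSpectrum R :=
      { toFun := fun q => ⟨q.1, q.2⟩
        invFun := fun q => ⟨q.1, q.2⟩
        left_inv := fun _ => rfl
        right_inv := fun _ => rfl
        map_rel_iff' := Iff.rfl }
    have h1 : p.height = Order.height (⟨p, hp⟩ : {q : Ideal R // q.IsPrime}) :=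
      (PrimeSpectrum.height_eq_orderHeight ⟨p, hp⟩).trans (Order.height_orderIso e ⟨p, hp⟩)
    rw [h1, ← h]
    exact iInf₂_le (⟨p, hp⟩ : {q : Ideal R // q.IsPrime}) hle
  have hxy : ¬ (x = 0 ∧ y = 0) := by
    rintro ⟨rfl, rfl⟩
    have := key ⊥ Ideal.isPrime_bot (by simp)
    simp at this
  refine WfDvdMonoid.isRelPrime_of_no_irreducible_factors hxy ?_
  intro z hz hzx hzy
  have hp : (Ideal.span {z}).IsPrime :=
    (Ideal.span_singleton_prime hz.ne_zero).2 (UniqueFactorizationMonoid.irreducible_iff_prime.1 hz)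
  have h2 := key _ hp (by
    rw [Ideal.span_le]
    rintro t (rfl | rfl)
    · exact Ideal.mem_span_singleton.2 hzx
    · exact Ideal.mem_span_singleton.2 hzy)
  have h1 := Ideal.height_le_one_of_isPrincipal_of_mem_minimalPrimes (Ideal.span {z})
    (Ideal.span {z}) (by rw [Ideal.minimalPrimes_eq_subsingleton_self]; rfl)
  exact absurd (h2.trans h1) (by decide)

theorem ne_zero_of_height {R : Type} [CommRing R] (x y : R)
    (h : idealHeight (Ideal.span {x, y}) = 2) (hr : IsRelPrime x y) : x ≠ 0 := by
  rintro rfl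
  have hu : IsUnit y := isRelPrime_zero_left.1 hr
  have : Ideal.span {0, y} = ⊤ := Ideal.eq_top_of_isUnit_mem _ (Ideal.subset_span (by simp)) hu
  rw [this] at h
  have h' : idealHeight (⊤ : Ideal R) = ⊤ := by
    unfold idealHeight
    simp only [iInf_eq_top]
    intro p hp
    exact absurd (top_le_iff.1 hp) p.2.ne_top
  rw [h'] at h
  exact absurd h (by decide)

/-- Reduction modulo a linear form, realised as an endomorphism. -/
theorem retract {k : Type} [Field k] {N : ℕ} (l : MvPolynomial (Fin N) k)
    (hl : l ≠ 0) (hl1 : l.IsHomogeneous 1) :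
    ∃ φ : MvPolynomial (Fin N) k →ₐ[k] MvPolynomial (Fin N) k,
      φ l = 0 ∧ (∀ p, l ∣ p - φ p) ∧ ∀ p, p.IsHomogeneous 1 → (φ p).IsHomogeneous 1 := by
  have hrep : ∃ c : Fin N → k, ∑ j, c j • (X j : MvPolynomial (Fin N) k) = l := by
    have hm : l ∈ homogeneousSubmodule (Fin N) k 1 := hl1
    rw [homogeneousSubmodule_one_eq_span_X] at hm
    exact (Submodule.mem_span_range_iff_exists_fun k).1 hm
  obtain ⟨c, hc⟩ := hrep
  obtain ⟨i, hi⟩ : ∃ i, c i ≠ 0 := by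
    by_contra! h
    exact hl (by rw [← hc]; simp [h])
  let g : Fin N → MvPolynomial (Fin N) k :=
    fun j => X j - (if j = i then (c i)⁻¹ else 0 : k) • l
  have hg : ∀ j, (g j).IsHomogeneous 1 := fun j =>
    ((homogeneousSubmodule (Fin N) k 1).sub_mem (isHomogeneous_X k j)
      ((homogeneousSubmodule (Fin N) k 1).smul_mem _ hl1))
  refine ⟨aeval g, ?_, ?_, ?_⟩
  · have : aeval g l = l - l := by
      conv_lhs => rw [← hc]
      rw [map_sum]
      simp only [map_smul, aeval_X, g, smul_sub, Finset.sum_sub_distrib, hc, smul_smul]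
      simp [← Finset.sum_smul, hi]
    rw [this, sub_self]
  · intro p
    induction p using MvPolynomial.induction_on with
    | C a => simp
    | add p q hp hq =>
      rw [map_add, add_sub_add_comm]
      exact dvd_add hp hq
    | mul_X p j hp =>
      rw [map_mul, aeval_X]
      have h2 : p * X j - aeval g p * g j = (p - aeval g p) * X j
          + aeval g p * ((if j = i then (c i)⁻¹ else 0 : k) • l) := by
        simp only [g]; ring
      rw [h2]
      refine dvd_add (hp.mul_right _) (Dvd.dvd.mul_left ?_ _)
      rw [smul_eq_C_mul]
      exact dvd_mul_left _ _
  · intro p hp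
    simpa using hp.aeval g hg

theorem exists_homog {k : Type} [Field k] {N : ℕ} {f₁ f₂ g : MvPolynomial (Fin N) k}
    (hf₁ : f₁.IsHomogeneous 3) (hf₂ : f₂.IsHomogeneous 3) (hg : g.IsHomogeneous 4)
    (h : g ∈ Ideal.span {f₁, f₂}) :
    ∃ a b : MvPolynomial (Fin N) k, a.IsHomogeneous 1 ∧ b.IsHomogeneous 1 ∧
      g = a * f₁ + b * f₂ := by
  let _ := MvPolynomial.gradedAlgebra (σ := Fin N) (R := k)
  obtain ⟨a, b, hab⟩ := Ideal.mem_span_pair.1 h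
  let 𝒜 := homogeneousSubmodule (Fin N) k
  refine ⟨DirectSum.decompose 𝒜 a 1, DirectSum.decompose 𝒜 b 1, (DirectSum.decompose 𝒜 a 1).2,
    (DirectSum.decompose 𝒜 b 1).2, ?_⟩
  have h1 := DirectSum.coe_decompose_mul_of_right_mem_of_le (𝒜 := 𝒜) (a := a) (n := 4) hf₁
    (by norm_num)
  have h2 := DirectSum.coe_decompose_mul_of_right_mem_of_le (𝒜 := 𝒜) (a := b) (n := 4) hf₂
    (by norm_num)
  have h3 : (DirectSum.decompose 𝒜 g 4 : MvPolynomial (Fin N) k) = g :=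
    DirectSum.decompose_of_mem_same 𝒜 hg
  rw [← hab, DirectSum.decompose_add] at h3
  rw [← hab]
  refine h3.symm.trans ?_
  exact congrArg₂ (· + ·) h1 h2

theorem main_case {k : Type} [Field k] {N : ℕ}
    (f₁ f₂ f₃ l a b : MvPolynomial (Fin N) k)
    (h1 : f₁ ≠ 0) (h2 : f₂ ≠ 0) (hr : IsRelPrime f₁ f₂) (hl : l ≠ 0) (hl1 : l.IsHomogeneous 1)
    (ha : a.IsHomogeneous 1) (e : l * f₃ = a * f₁ + b * f₂)
    (hla : ¬ l ∣ a) : pdq (Ideal.span {f₁, f₂, f₃}) 4 := by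
  obtain ⟨φ, φl, φd, φh⟩ := retract l hl hl1
  have φz : ∀ p, φ p = 0 → l ∣ p := fun p hp => by simpa [hp] using φd p
  have φa : φ a ≠ 0 := fun h => hla (φz a h)
  have hlp : ∀ x y, l ∣ x * y → l ∣ x ∨ l ∣ y := by
    rintro x y ⟨z, hz⟩
    have := congrArg φ hz
    rw [map_mul, map_mul, φl, zero_mul, mul_eq_zero] at this
    exact this.imp (φz x) (φz y)
  obtain ⟨ψ', ψa, ψd, -⟩ := retract (φ a) φa (φh a ha)
  let ψ := ψ'.comp φ
  have ψl : ψ l = 0 := by simp [ψ, φl]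
  have ψa : ψ a = 0 := by simp [ψ, ψa]
  have ψz : ∀ p, ψ p = 0 → ∃ u w, p = l * u + a * w := by
    intro p hp
    obtain ⟨w, hw⟩ := ψd (φ p)
    have hp' : ψ' (φ p) = 0 := hp
    rw [hp', sub_zero] at hw
    obtain ⟨u, hu⟩ := φd p
    obtain ⟨v, hv⟩ := φd a
    refine ⟨u - v * w, w, ?_⟩
    linear_combination hu + hw - w * hv
  have hbf : ψ b * ψ f₂ = 0 := by
    have := congrArg ψ e
    rw [map_add, map_mul, map_mul, map_mul, ψl, ψa, zero_mul, zero_mul, zero_add] at this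
    exact this.symm
  have canc : ∀ x y, l * x = l * y → x = y := fun x y h => mul_left_cancel₀ hl h
  rcases mul_eq_zero.1 hbf with hb0 | hf0
  · obtain ⟨e', c, hbc⟩ := ψz b hb0
    have h3 : l ∣ a * (f₁ + c * f₂) := ⟨f₃ - e' * f₂, by rw [hbc] at e; linear_combination -e⟩
    obtain ⟨q, hq⟩ := (hlp _ _ h3).resolve_left hla
    have hq3 : f₃ - e' * f₂ = a * q := canc _ _ (by
      rw [hbc] at e; linear_combination e + a * hq)
    have hqr : IsRelPrime f₂ q := by
      intro d d2 dq
      refine hr ?_ d2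
      have : f₁ = l * q - c * f₂ := by linear_combination hq
      rw [this]
      exact dvd_sub (dq.mul_left _) (d2.mul_left _)
    have hla3 : pdq (Ideal.span {l, a}) 3 := by
      rw [pair_eq]
      refine pdq_reg _ a 2 (fun z hz => ?_) (pdq_one l hl)
      rw [Ideal.mem_span_singleton] at *
      exact (hlp _ _ hz).resolve_left hla
    have hK : pdq (Ideal.span {l, a} ⊔ Ideal.span {f₂}) 4 := by
      by_cases hf : ψ f₂ = 0
      · obtain ⟨u, w, huw⟩ := ψz f₂ hf
        have : Ideal.span {l, a} ⊔ Ideal.span {f₂} = Ideal.span {l, a} := by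
          rw [sup_eq_left, Ideal.span_singleton_le_iff_mem, Ideal.mem_span_pair]
          exact ⟨u, w, by rw [huw]; ring⟩
        rw [this]
        exact pdq_mono (by norm_num) hla3
      · refine pdq_reg _ f₂ 3 (fun z hz => ?_) hla3
        rw [Ideal.mem_span_pair] at hz
        obtain ⟨u, w, huw⟩ := hz
        have := congrArg ψ huw
        rw [map_add, map_mul, map_mul, map_mul, ψl, ψa, mul_zero, mul_zero, zero_add] at this
        obtain ⟨u, w, huw⟩ := ψz z ((mul_eq_zero.1 this.symm).resolve_left hf)
        exact Ideal.mem_span_pair.2 ⟨u, w, by rw [huw]; ring⟩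
    refine pdq_mid _ _ (Ideal.span {f₂, q}) q 4 ?_ ?_ hK
      (pdq_mono (by norm_num) (pdq_two f₂ q h2 hqr))
    · intro y
      have m1 : f₁ ∈ Ideal.span {f₁, f₂, f₃} := Ideal.subset_span (by simp)
      have m2 : f₂ ∈ Ideal.span {f₁, f₂, f₃} := Ideal.subset_span (by simp)
      have m3 : f₃ ∈ Ideal.span {f₁, f₂, f₃} := Ideal.subset_span (by simp)
      constructor
      · intro hy
        obtain ⟨s, hs, t, ht, rfl⟩ := Submodule.mem_sup.1 hy
        obtain ⟨u, w, rfl⟩ := Ideal.mem_span_pair.1 hs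
        obtain ⟨t, rfl⟩ := Ideal.mem_span_singleton'.1 ht
        have : q * (u * l + w * a + t * f₂) =
            u * f₁ + (u * c - w * e' + t * q) * f₂ + w * f₃ := by
          linear_combination -u * hq - w * hq3
        rw [this]
        exact add_mem (add_mem (Ideal.mul_mem_left _ _ m1) (Ideal.mul_mem_left _ _ m2))
          (Ideal.mul_mem_left _ _ m3)
      · intro hy
        obtain ⟨u, z, hz, hu⟩ := Ideal.mem_span_insert.1 hy
        obtain ⟨v, w, rfl⟩ := Ideal.mem_span_pair.1 hz
        have : f₂ ∣ q * (y - u * l - w * a) := ⟨v - u * c + w * e', by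
          linear_combination hu + u * hq + w * hq3⟩
        obtain ⟨t, ht⟩ := hqr.dvd_of_dvd_mul_left this
        refine Submodule.mem_sup.2 ⟨u * l + w * a, Ideal.mem_span_pair.2 ⟨u, w, rfl⟩, t * f₂,
          Ideal.mem_span_singleton'.2 ⟨t, rfl⟩, by linear_combination -ht⟩
    · apply le_antisymm
      · rw [Ideal.span_le]
        rintro x (rfl | rfl)
        · exact Submodule.mem_sup_left (Ideal.subset_span (by simp))
        · exact Submodule.mem_sup_right (Ideal.subset_span (by simp))
      · refine sup_le ?_ (Ideal.span_mono (by simp))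
        rw [Ideal.span_le]
        rintro x (rfl | rfl | rfl)
        · exact Ideal.mem_span_pair.2 ⟨-c, l, by linear_combination -hq⟩
        · exact Ideal.subset_span (by simp)
        · exact Ideal.mem_span_pair.2 ⟨e', a, by linear_combination -hq3⟩
  · obtain ⟨u, w, hf2⟩ := ψz f₂ hf0
    -- f₂ = l u + a w, f₁ = -b w - l v
    have h3 : l ∣ a * (f₁ + b * w) := ⟨f₃ - b * u, by rw [hf2] at e; linear_combination -e⟩
    obtain ⟨v, hv⟩ := (hlp _ _ h3).resolve_left hla
    have hf3 : f₃ - b * u = a * v := canc _ _ (by rw [hf2] at e; linear_combination e + a * hv)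
    have hlw : IsRelPrime l w := by
      intro d dl dw
      refine hr ?_ ?_
      · have : f₁ = l * v - b * w := by linear_combination hv
        rw [this]
        exact dvd_sub (dl.mul_right _) (dw.mul_left _)
      · rw [hf2]
        exact dvd_add (dl.mul_right _) (dw.mul_left _)
    refine pdq_quot (Ideal.span {f₁, f₂}) (Ideal.span {l, w}) _ f₃ 3 ?_ ?_
      (pdq_two l w hl hlw) (pdq_mono (by norm_num) (pdq_two f₁ f₂ h1 hr))
    · intro y
      constructor
      · intro hy
        obtain ⟨s, t, rfl⟩ := Ideal.mem_span_pair.1 hy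
        refine Ideal.mem_span_pair.2 ⟨s * a - t * u, s * b + t * v, ?_⟩
        linear_combination -s * e - t * u * hv + t * v * hf2 - t * w * hf3
      · intro hy
        obtain ⟨s, t, hst⟩ := Ideal.mem_span_pair.1 hy
        have : f₂ ∣ f₁ * (y * a - l * s) := ⟨l * t - y * b, by
          linear_combination -y * e - l * hst⟩
        obtain ⟨x, hx⟩ := hr.symm.dvd_of_dvd_mul_left this
        have : l ∣ a * (y - x * w) := ⟨s + x * u, by linear_combination hx + x * hf2⟩
        obtain ⟨z, hz⟩ := (hlp _ _ this).resolve_left hla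
        exact Ideal.mem_span_pair.2 ⟨z, x, by linear_combination -hz⟩
    · rw [← Ideal.span_union]
      congr 1
      ext; simp; tauto


theorem statement_1
    {k : Type} [Field k] [IsAlgClosed k] {N : ℕ}
    (f₁ f₂ f₃ : MvPolynomial (Fin N) k)
    (hf₁ : f₁.IsHomogeneous 3) (hf₂ : f₂.IsHomogeneous 3) (hf₃ : f₃.IsHomogeneous 3)
    (hIht : idealHeight (Ideal.span {f₁, f₂, f₃}) = 2)
    (hht₁₂ : idealHeight (Ideal.span {f₁, f₂}) = 2)
    (hht₁₃ : idealHeight (Ideal.span {f₁, f₃}) = 2)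
    (hht₂₃ : idealHeight (Ideal.span {f₂, f₃}) = 2)
    (hL : ∃ ℓ ∈ Submodule.colon (Ideal.span {f₁, f₂}) (Ideal.span {f₃}), ℓ ≠ 0 ∧ MvPolynomial.IsHomogeneous ℓ 1) :
    pdQuotLE (Ideal.span {f₁, f₂, f₃}) 3 := by
  obtain ⟨l, hlL, hl, hl1⟩ := hL
  have hr := relPrime_of_height f₁ f₂ hht₁₂
  have h1 := ne_zero_of_height f₁ f₂ hht₁₂ hr
  have h2 : f₂ ≠ 0 := ne_zero_of_height f₂ f₁ (by rw [Set.pair_comm]; exact hht₁₂) hr.symm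
  have hm : l * f₃ ∈ Ideal.span {f₁, f₂} :=
    Submodule.mem_colon.1 hlL f₃ (Ideal.mem_span_singleton_self f₃)
  obtain ⟨a, b, ha, hb, e⟩ := exists_homog hf₁ hf₂ (hl1.mul hf₃) hm
  refine exists_res 3 _ ?_
  change pdq _ 4
  by_cases hla : l ∣ a
  · by_cases hlb : l ∣ b
    · obtain ⟨s, rfl⟩ := hla
      obtain ⟨t, rfl⟩ := hlb
      have h3 : f₃ = s * f₁ + t * f₂ :=
        mul_left_cancel₀ hl (by linear_combination e)
      have : Ideal.span {f₁, f₂, f₃} = Ideal.span {f₁, f₂} := by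
        apply le_antisymm
        · rw [Ideal.span_le]
          rintro x (rfl | rfl | rfl)
          · exact Ideal.subset_span (by simp)
          · exact Ideal.subset_span (by simp)
          · exact Ideal.mem_span_pair.2 ⟨s, t, h3.symm⟩
        · exact Ideal.span_mono (by intro x; simp; tauto)
      rw [this]
      exact pdq_mono (by norm_num) (pdq_two f₁ f₂ h1 hr)
    · rw [Set.insert_comm]
      exact main_case f₂ f₁ f₃ l b a h2 h1 hr.symm hl hl1 hb (by rw [e, add_comm]) hlb
  · exact main_case f₁ f₂ f₃ l a b h1 h2 hr hl hl1 ha e hla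

end
end

section
/- Let J be an almost complete intersection ideal of height g in R = k[x_1, ..., x_n]. If there exists a regular sequence of forms h_1, ..., h_t such that either the unmixed part J^un of J, or some ideal linked to J^un, is extended from the subring A = k[h_1, ..., h_t], then pd(R/J) ≤ max{g + 1, t}. -/
open MvPolynomial Filter CategoryTheory

noncomputable section

set_option linter.style.haveILetI false
set_option linter.unusedSectionVars false
set_option linter.unusedVariables false
set_option linter.unusedSimpArgs false

namespace ACI

/-- `xs` is a (weakly) regular sequence modulo the ideal `I`. -/
def RegL {R : Type} [CommRing R] : Ideal R → List R → Prop
  | _, [] => True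
  | I, x :: xs => (∀ a, x * a ∈ I → a ∈ I) ∧ RegL (I ⊔ Ideal.span {x}) xs

/-- `x` is a nonzerodivisor modulo `I`. -/
def Nzd {R : Type} [CommRing R] (I : Ideal R) (x : R) : Prop := ∀ a, x * a ∈ I → a ∈ I

section Basic
variable {R : Type} [CommRing R]

lemma ofList_append_single (xs : List R) (x : R) :
    Ideal.ofList (xs ++ [x]) = Ideal.ofList xs ⊔ Ideal.span {x} := by
  simp

lemma regL_append (I : Ideal R) (xs ys : List R) :
    RegL I (xs ++ ys) ↔ RegL I xs ∧ RegL (I ⊔ Ideal.ofList xs) ys := by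
  induction xs generalizing I with
  | nil => simp [RegL]
  | cons x xs ih =>
    simp only [List.cons_append, RegL, ih, Ideal.ofList_cons, and_assoc, sup_assoc]

lemma regL_snoc (I : Ideal R) (xs : List R) (y : R) :
    RegL I (xs ++ [y]) ↔ RegL I xs ∧ Nzd (I ⊔ Ideal.ofList xs) y := by
  simp [regL_append, RegL, Nzd]

/-- Coset version of prime avoidance. -/
lemma coset_avoid (S : Finset (Ideal R)) (hS : ∀ p ∈ S, p.IsPrime) (x : R) (I : Ideal R)
    (h : ∀ p ∈ S, ¬ (Ideal.span {x} ⊔ I ≤ p)) : ∃ i ∈ I, ∀ p ∈ S, x + i ∉ p := by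
  classical
  induction hn : S.card generalizing S with
  | zero =>
    rw [Finset.card_eq_zero] at hn
    subst hn
    exact ⟨0, I.zero_mem, by simp⟩
  | succ n ih =>
    have hne : S.Nonempty := by
      rw [← Finset.card_pos]; omega
    obtain ⟨P, hP, hmin⟩ := S.exists_minimal hne
    obtain ⟨i, hi, hi'⟩ := ih (S.erase P) (fun p hp => hS p (Finset.mem_of_mem_erase hp))
      (fun p hp => h p (Finset.mem_of_mem_erase hp)) (by rw [Finset.card_erase_of_mem hP]; omega)
    by_cases hx : x + i ∈ P
    · have hPp := hS P hP
      have hIP : ¬ I ≤ P := by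
        intro hle
        apply h P hP
        rw [sup_le_iff, Ideal.span_singleton_le_iff_mem]
        refine ⟨?_, hle⟩
        have := P.sub_mem hx (hle hi)
        simpa using this
      have hprod : ¬ (I * ∏ p ∈ S.erase P, p) ≤ P := by
        intro hle
        rcases hPp.mul_le.1 hle with h1 | h1
        · exact hIP h1
        · rw [Ideal.IsPrime.prod_le hPp] at h1
          obtain ⟨p, hp, hpP⟩ := h1
          have h2 := hmin (Finset.mem_of_mem_erase hp) hpP
          exact (Finset.ne_of_mem_erase hp) (le_antisymm hpP h2)
      obtain ⟨y, hy, hyP⟩ := Set.not_subset.1 hprod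
      refine ⟨i + y, I.add_mem hi ((Ideal.mul_le_left : I * (∏ p ∈ S.erase P, p) ≤ I) hy), ?_⟩
      intro p hp hmem
      by_cases hpP : p = P
      · subst hpP
        apply hyP
        have := p.sub_mem hmem hx
        simpa [← add_assoc] using this
      · have hpe : p ∈ S.erase P := Finset.mem_erase.2 ⟨hpP, hp⟩
        apply hi' p hpe
        have hyp : y ∈ p := by
          have h1 : (I * ∏ p ∈ S.erase P, p) ≤ p :=
            Ideal.mul_le_right.trans (Ideal.prod_le_inf.trans (Finset.inf_le hpe))
          exact h1 hy
        have := p.sub_mem hmem hyp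
        simpa [← add_assoc] using this
    · refine ⟨i, hi, fun p hp => ?_⟩
      by_cases hpP : p = P
      · subst hpP; exact hx
      · exact hi' p (Finset.mem_erase.2 ⟨hpP, hp⟩)

/-- Elementwise associated primes of `R/I`. -/
def Assoc (I : Ideal R) : Set (Ideal R) :=
  {p | p.IsPrime ∧ ∃ z, ∀ a, a ∈ p ↔ a * z ∈ I}

variable [IsNoetherianRing R]

lemma assoc_eq (I : Ideal R) : Assoc I = associatedPrimes R (R ⧸ I) := by
  ext p
  rw [AssociatedPrimes.mem_iff, isAssociatedPrime_iff]
  refine and_congr_right fun hp => ?_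
  have key : ∀ z : R, (p = Submodule.colon (⊥ : Submodule R (R ⧸ I)) {Ideal.Quotient.mk I z}) ↔
      ∀ a, a ∈ p ↔ a * z ∈ I := by
    intro z
    rw [SetLike.ext_iff]
    refine forall_congr' fun a => ?_
    rw [Submodule.mem_colon_singleton, Submodule.mem_bot, ← Ideal.Quotient.eq_zero_iff_mem (I := I),
      map_mul]
    rfl
  constructor
  · rintro ⟨z, hz⟩
    exact ⟨_, (key z).2 hz⟩
  · rintro ⟨x, hx⟩
    obtain ⟨z, rfl⟩ := Ideal.Quotient.mk_surjective x
    exact ⟨z, (key z).1 hx⟩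

lemma assoc_finite (I : Ideal R) : (Assoc I).Finite := by
  rw [assoc_eq]
  exact associatedPrimes.finite R (R ⧸ I)

lemma exists_assoc (I : Ideal R) (z : R) (hz : z ∉ I) :
    ∃ p ∈ Assoc I, ∀ a, a * z ∈ I → a ∈ p := by
  obtain ⟨P, hP, hle⟩ := exists_le_isAssociatedPrime_of_isNoetherianRing R (Ideal.Quotient.mk I z)
    (by rwa [Ne, Ideal.Quotient.eq_zero_iff_mem])
  refine ⟨P, by rw [assoc_eq]; exact hP, fun a ha => hle ?_⟩
  rw [Submodule.mem_colon_singleton, Submodule.mem_bot]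
  rw [← Ideal.Quotient.eq_zero_iff_mem, map_mul] at ha
  exact ha

lemma assoc_le {I p : Ideal R} (h : p ∈ Assoc I) : I ≤ p := by
  obtain ⟨hp, z, hz⟩ := h
  intro a ha
  rw [hz]
  exact I.mul_mem_right _ ha

lemma nzd_of_avoid (I : Ideal R) (x : R) (h : ∀ p ∈ Assoc I, x ∉ p) : Nzd I x := by
  intro a ha
  by_contra hna
  obtain ⟨p, hp, hle⟩ := exists_assoc I a hna
  exact h p hp (hle _ ha)

lemma avoid_of_nzd (I : Ideal R) (x : R) (h : Nzd I x) : ∀ p ∈ Assoc I, x ∉ p := by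
  rintro p ⟨hp, z, hz⟩ hx
  rw [hz] at hx
  have h1 := h _ hx
  apply hp.ne_top
  rw [Ideal.eq_top_iff_one, hz, one_mul]
  exact h1

/-- An ideal containing a nonzerodivisor modulo each of finitely many ideals contains a common
one. -/
lemma exists_common_nzd (S : Finset (Ideal R)) (H : Ideal R)
    (h : ∀ I ∈ S, ∃ x ∈ H, Nzd I x) : ∃ e ∈ H, ∀ I ∈ S, Nzd I e := by
  classical
  let T : Finset (Ideal R) := S.biUnion fun I => (assoc_finite I).toFinset
  have hT : ∀ p, p ∈ T ↔ ∃ I ∈ S, p ∈ Assoc I := by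
    intro p; simp [T]
  obtain ⟨e, he, h'⟩ := coset_avoid T (fun p hp => by
      obtain ⟨I, -, hI⟩ := (hT p).1 hp
      exact hI.1) 0 H (fun p hp hle => by
      obtain ⟨I, hIS, hI⟩ := (hT p).1 hp
      obtain ⟨x, hx, hx'⟩ := h I hIS
      exact avoid_of_nzd I x hx' p hI (hle (Ideal.mem_sup_right hx)))
  refine ⟨e, he, fun I hI => nzd_of_avoid I e fun p hp => ?_⟩
  have := h' p ((hT p).2 ⟨I, hI, hp⟩)
  simpa using this

/-- Exchange: if `x, e` is regular mod `I` and `e` is regular mod `I`, then `x` is regular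
mod `I + (e)`. -/
lemma nzd_exchange (I : Ideal R) (x e : R) (hx : Nzd I x) (he : Nzd I e)
    (hxe : Nzd (I ⊔ Ideal.span {x}) e) : Nzd (I ⊔ Ideal.span {e}) x := by
  intro a ha
  rw [Submodule.mem_sup] at ha
  obtain ⟨i, hi, b, hb, hab⟩ := ha
  obtain ⟨c, rfl⟩ := Ideal.mem_span_singleton'.1 hb
  have h1 : e * c ∈ I ⊔ Ideal.span {x} := by
    have : e * c = (-i) + a * x := by linear_combination hab
    rw [this]
    exact Ideal.add_mem _ (Ideal.mem_sup_left (I.neg_mem hi))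
      (Ideal.mem_sup_right (Ideal.mem_span_singleton'.2 ⟨a, rfl⟩))
  have h2 := hxe _ h1
  rw [Submodule.mem_sup] at h2
  obtain ⟨j, hj, d', hd, hjd⟩ := h2
  obtain ⟨d, rfl⟩ := Ideal.mem_span_singleton'.1 hd
  have h3 : x * (a - d * e) ∈ I := by
    have : x * (a - d * e) = i + j * e := by
      linear_combination (-1 : R) * hab - e * hjd
    rw [this]
    exact I.add_mem hi (I.mul_mem_right _ hj)
  have h4 := hx _ h3
  have : a = (a - d * e) + d * e := by ring
  rw [this]
  exact Ideal.add_mem _ (Ideal.mem_sup_left h4)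
      (Ideal.mem_sup_right (Ideal.mem_span_singleton'.2 ⟨d, rfl⟩))

lemma regL_exchange (I : Ideal R) (u : List R) (e : R) (hu : RegL I u)
    (he : ∀ i ≤ u.length, Nzd (I ⊔ Ideal.ofList (u.take i)) e) :
    RegL (I ⊔ Ideal.span {e}) u := by
  induction u generalizing I with
  | nil => trivial
  | cons x u ih =>
    refine ⟨nzd_exchange I x e hu.1 (by simpa using he 0 (by simp)) (by simpa using he 1 (by simp)), ?_⟩
    rw [sup_right_comm]
    refine ih _ hu.2 fun i hi => ?_
    have := he (i + 1) (by simpa using hi)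
    simpa [sup_assoc] using this

/-- The chain principle: a property of ideals that is invariant under swapping the last element
of a regular sequence inside `H` is shared by any two regular sequences in `H` of the same
length. -/
lemma chain (H : Ideal R) (Q : Ideal R → Prop) (T : ℕ → Ideal R → Prop) (g : ℕ)
    (hT : ∀ j I x, x ∈ H → T j I → Nzd I x → T (j + 1) (I ⊔ Ideal.span {x}))
    (hQ : ∀ j I x y, j + 1 = g → T j I → x ∈ H → y ∈ H → Nzd I x → Nzd I y →
      Q (I ⊔ Ideal.span {x}) → Q (I ⊔ Ideal.span {y})) (m : ℕ) :
    ∀ (j : ℕ) (I : Ideal R) (u v : List R), j + m = g → T j I → u.length = m → v.length = m →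
      (∀ x ∈ u, x ∈ H) → (∀ x ∈ v, x ∈ H) → RegL I u → RegL I v →
      Q (I ⊔ Ideal.ofList u) → Q (I ⊔ Ideal.ofList v) := by
  classical
  have hTl : ∀ (u : List R) (j : ℕ) (I : Ideal R), (∀ x ∈ u, x ∈ H) → T j I → RegL I u →
      T (j + u.length) (I ⊔ Ideal.ofList u) := by
    intro u
    induction u with
    | nil => intro j I _ h _; simpa using h
    | cons x u ih =>
      intro j I hu h hr
      have := ih (j + 1) (I ⊔ Ideal.span {x}) (fun y hy => hu y (by simp [hy]))
        (hT j I x (hu x (by simp)) h hr.1) hr.2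
      rw [Ideal.ofList_cons, ← sup_assoc]
      convert this using 1
      simp only [List.length_cons]; omega
  induction m with
  | zero =>
    intro j I u v _ _ hu hv _ _ _ _ h
    rw [List.length_eq_zero_iff] at hu hv
    subst hu hv
    exact h
  | succ m ih =>
    intro j I u v hj hTj hu hv huH hvH hru hrv h
    obtain ⟨u', x, rfl⟩ := List.eq_nil_or_concat' u |>.resolve_left (by rintro rfl; simp at hu)
    obtain ⟨v', y, rfl⟩ := List.eq_nil_or_concat' v |>.resolve_left (by rintro rfl; simp at hv)
    have hu' : u'.length = m := by simpa using hu
    have hv' : v'.length = m := by simpa using hv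
    have hex : ∀ (w : List R) (z : R), RegL I (w ++ [z]) → (∀ x ∈ w ++ [z], x ∈ H) →
        ∀ i ≤ w.length, ∃ x ∈ H, Nzd (I ⊔ Ideal.ofList (w.take i)) x := by
      intro w z hr hH i hi
      have hlt : i < (w ++ [z]).length := by simp; omega
      refine ⟨(w ++ [z])[i], hH _ (List.getElem_mem hlt), ?_⟩
      have h1 : w ++ [z] = (w.take i ++ [(w ++ [z])[i]]) ++ (w ++ [z]).drop (i + 1) := by
        conv_lhs => rw [← List.take_append_drop (i + 1) (w ++ [z])]
        rw [List.take_succ_eq_append_getElem hlt, List.take_append_of_le_length hi]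
      rw [h1, regL_append, regL_snoc] at hr
      exact hr.1.2
    let S : Finset (Ideal R) :=
      (Finset.range (m + 1)).image (fun i => I ⊔ Ideal.ofList (u'.take i)) ∪
      (Finset.range (m + 1)).image (fun i => I ⊔ Ideal.ofList (v'.take i))
    obtain ⟨e, heH, he⟩ := exists_common_nzd S H (by
      intro K hK
      rcases Finset.mem_union.1 hK with hK | hK
      · obtain ⟨i, hi, rfl⟩ := Finset.mem_image.1 hK
        exact hex u' x hru huH i (by rw [Finset.mem_range] at hi; omega)
      · obtain ⟨i, hi, rfl⟩ := Finset.mem_image.1 hK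
        exact hex v' y hrv hvH i (by rw [Finset.mem_range] at hi; omega))
    have heu : ∀ i ≤ u'.length, Nzd (I ⊔ Ideal.ofList (u'.take i)) e := fun i hi =>
      he _ (Finset.mem_union_left _ (Finset.mem_image.2 ⟨i, by
        rw [Finset.mem_range]; omega, rfl⟩))
    have hev : ∀ i ≤ v'.length, Nzd (I ⊔ Ideal.ofList (v'.take i)) e := fun i hi =>
      he _ (Finset.mem_union_right _ (Finset.mem_image.2 ⟨i, by
        rw [Finset.mem_range]; omega, rfl⟩))
    rw [regL_snoc] at hru hrv
    have hu'H : ∀ x ∈ u', x ∈ H := fun z hz => huH z (by simp [hz])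
    have hv'H : ∀ x ∈ v', x ∈ H := fun z hz => hvH z (by simp [hz])
    have s1 : Q ((I ⊔ Ideal.ofList u') ⊔ Ideal.span {e}) := by
      refine hQ (j + u'.length) _ x e (by omega) (hTl u' j I hu'H hTj hru.1)
        (huH x (by simp)) heH hru.2 (by simpa using heu u'.length le_rfl) ?_
      simpa [sup_assoc] using h
    have s2 : Q ((I ⊔ Ideal.span {e}) ⊔ Ideal.ofList v') := by
      refine ih (j + 1) (I ⊔ Ideal.span {e}) u' v' (by omega)
        (hT j I e heH hTj (by simpa using heu 0 (by simp))) hu' hv' hu'H hv'H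
        (regL_exchange I u' e hru.1 heu) (regL_exchange I v' e hrv.1 hev) ?_
      rw [sup_right_comm]; exact s1
    rw [ofList_append_single, ← sup_assoc]
    refine hQ (j + v'.length) _ e y (by omega) (hTl v' j I hv'H hTj hrv.1) heH
      (hvH y (by simp)) (by simpa using hev v'.length le_rfl) hrv.2 ?_
    rw [sup_right_comm]; exact s2

/-- Cross-multiplication underlying the swap of the last element. -/
lemma swap_mul (I H : Ideal R) (x y : R) (hx : Nzd I x) (hyH : y ∈ H)
    (a : R) (ha : ∀ h ∈ H, a * h ∈ I ⊔ Ideal.span {x}) :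
    ∃ b, y * a - x * b ∈ I ∧ ∀ h ∈ H, b * h ∈ I ⊔ Ideal.span {y} := by
  obtain ⟨i, hi, b', hb, hab⟩ := Submodule.mem_sup.1 (ha y hyH)
  obtain ⟨b, rfl⟩ := Ideal.mem_span_singleton'.1 hb
  refine ⟨b, ?_, fun h hh => ?_⟩
  · have : y * a - x * b = i := by linear_combination (-1 : R) * hab
    rwa [this]
  · obtain ⟨j, hj, d', hd, hjd⟩ := Submodule.mem_sup.1 (ha h hh)
    obtain ⟨d, rfl⟩ := Ideal.mem_span_singleton'.1 hd
    have h3 : x * (b * h - y * d) ∈ I := by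
      have : x * (b * h - y * d) = j * y - i * h := by
        linear_combination h * hab - y * hjd
      rw [this]
      exact I.sub_mem (I.mul_mem_right _ hj) (I.mul_mem_right _ hi)
    have : b * h = (b * h - y * d) + d * y := by ring
    rw [this]
    exact Ideal.add_mem _ (Ideal.mem_sup_left (hx _ h3))
      (Ideal.mem_sup_right (Ideal.mem_span_singleton'.2 ⟨d, rfl⟩))

/-- Comparison of lengths of regular sequences in an ideal killing an element. -/
lemma grade_lemma (P : Ideal R) (xs rs : List R) (hxs : RegL ⊥ xs) (hrs : RegL ⊥ rs)
    (hxP : ∀ x ∈ xs, x ∈ P) (hrP : ∀ x ∈ rs, x ∈ P) (hlen : rs.length < xs.length) (z : R)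
    (hz : ∀ a ∈ P, a * z ∈ Ideal.ofList rs) : z ∈ Ideal.ofList rs := by
  have key := chain P (fun I => ∀ z, (∀ a ∈ P, z * a ∈ I) → z ∈ I) (fun _ _ => True) rs.length
    (fun _ _ _ _ _ _ => trivial) (by
      intro j I x y _ _ hxP hyP hx hy hQ z hz
      obtain ⟨b, hb, hbP⟩ := swap_mul I P y x hy hxP z hz
      obtain ⟨i, hi, c', hc, hic⟩ := Submodule.mem_sup.1 (hQ b hbP)
      obtain ⟨c, rfl⟩ := Ideal.mem_span_singleton'.1 hc
      have h1 : x * (z - y * c) ∈ I := by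
        have : x * (z - y * c) = (x * z - y * b) + i * y := by
          linear_combination (-y) * hic
        rw [this]
        exact I.add_mem hb (I.mul_mem_right _ hi)
      have : z = (z - y * c) + c * y := by ring
      rw [this]
      exact Ideal.add_mem _ (Ideal.mem_sup_left (hx _ h1))
        (Ideal.mem_sup_right (Ideal.mem_span_singleton'.2 ⟨c, rfl⟩))) rs.length 0 ⊥
    (xs.take rs.length) rs (by simp) trivial (by simp; omega) rfl
    (fun x hx => hxP x (List.mem_of_mem_take hx)) hrP (by
      rw [← List.take_append_drop rs.length xs, regL_append] at hxs
      exact hxs.1) hrs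
  rw [bot_sup_eq, bot_sup_eq] at key
  refine key ?_ z (fun a ha => by rw [mul_comm]; exact hz a ha)
  intro z hz
  have h1 : xs.take (rs.length + 1) = xs.take rs.length ++ [xs[rs.length]] := by
    rw [List.take_succ_eq_append_getElem hlen]
  rw [← List.take_append_drop (rs.length + 1) xs, regL_append, h1, regL_snoc] at hxs
  have h2 := hxs.1.2
  rw [bot_sup_eq] at h2
  exact h2 z (by rw [mul_comm]; exact hz _ (hxP _ (List.getElem_mem hlen)))

end Basic
end ACI

namespace ACI

/-- Unmixedness of ideals generated by regular sequences. -/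
def CM (B : Type) [CommRing B] : Prop :=
  ∀ rs : List B, RegL ⊥ rs → ∀ p ∈ Assoc (Ideal.ofList rs), p.height ≤ rs.length

/-- A regular sequence extends while the target ideal has big height. -/
lemma exists_reg_in {B : Type} [CommRing B] [IsNoetherianRing B] (hB : CM B) (I : Ideal B) (m : ℕ)
    (hI : ∀ p : Ideal B, p.IsPrime → I ≤ p → (m : ℕ∞) ≤ p.height) :
    ∃ b : List B, b.length = m ∧ RegL ⊥ b ∧ ∀ x ∈ b, x ∈ I := by
  induction m with
  | zero => exact ⟨[], rfl, trivial, by simp⟩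
  | succ m ih =>
    obtain ⟨b, hb, hr, hbI⟩ := ih (fun p hp hle => le_trans (by simp) (hI p hp hle))
    obtain ⟨x, hx, hav⟩ := coset_avoid (assoc_finite (Ideal.ofList b)).toFinset
      (fun p hp => ((assoc_finite _).mem_toFinset.1 hp).1) 0 I (fun p hp hle => by
        rw [(assoc_finite _).mem_toFinset] at hp
        have h1 := hB b hr p hp
        have h2 := hI p hp.1 (le_sup_right.trans hle)
        rw [hb] at h1
        have h3 := h2.trans h1
        norm_cast at h3
        omega)
    refine ⟨b ++ [x], by simp [hb], ?_, ?_⟩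
    · rw [regL_snoc, bot_sup_eq]
      refine ⟨hr, nzd_of_avoid _ _ fun p hp => ?_⟩
      simpa using hav p ((assoc_finite _).mem_toFinset.2 hp)
    · intro y hy
      rcases List.mem_append.1 hy with h | h
      · exact hbI y h
      · rw [List.mem_singleton] at h; rwa [h]

lemma cm_field (k : Type) [Field k] : CM k := by
  intro rs _ p hp
  have := hp.1
  have : p = ⊥ := (Ideal.eq_bot_or_top p).resolve_right hp.1.ne_top
  rw [this, Ideal.height_bot]
  simp

section poly
open Polynomial
variable {B : Type} [CommRing B] [IsNoetherianRing B]

attribute [local instance] Polynomial.algebra Polynomial.isLocalization in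
lemma height_poly_le (P : Ideal B[X]) [P.IsPrime] (p : Ideal B) (hp : p = P.comap Polynomial.C) :
    P.height ≤ p.height + 1 := by
  have hlo : P.LiesOver p := ⟨hp⟩
  have : p.IsPrime := by rw [hp]; infer_instance
  let Rₚ := Localization.AtPrime p
  set p' : Ideal Rₚ := p.map (algebraMap B Rₚ) with p'_def
  have : p'.IsMaximal := by
    rw [p'_def, Localization.AtPrime.map_eq_maximalIdeal]
    exact IsLocalRing.maximalIdeal.isMaximal Rₚ
  let P' : Ideal Rₚ[X] := P.map (algebraMap B[X] Rₚ[X])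
  have disj : Disjoint (p.primeCompl.map Polynomial.C : Set B[X]) P := by
    refine Set.disjoint_left.mpr fun a ⟨b, hb⟩ ha ↦ hb.1 ?_
    rw [SetLike.mem_coe, hp, Ideal.mem_comap, hb.2]
    exact ha
  have eq1 : p.height = p'.height := by
    rw [IsLocalization.height_map_of_disjoint p.primeCompl]
    exact Disjoint.symm <| Set.disjoint_left.mpr fun _ a b ↦ b a
  have eq2 : P.height = P'.height := by
    rw [IsLocalization.height_map_of_disjoint (Submonoid.map Polynomial.C <| p.primeCompl) _ disj]
  have hP'p : P'.IsPrime := IsLocalization.isPrime_of_isPrime_disjoint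
    (Submonoid.map Polynomial.C p.primeCompl) _ P ‹_› disj
  have : P'.LiesOver p' := IsLocalization.liesOver_of_isPrime_of_disjoint p.primeCompl _ _ disj
  obtain ⟨M, hM, hle⟩ := P'.exists_le_maximal hP'p.ne_top
  have hMl : M.LiesOver p' := ⟨by
    refine (Ideal.IsMaximal.eq_of_le ‹_› (Ideal.IsPrime.ne_top inferInstance) ?_)
    rw [P'.over_def p']
    exact Ideal.comap_mono hle⟩
  rw [eq1, eq2, ← Polynomial.height_eq_height_add_one p' M]
  exact Ideal.height_mono hle

lemma height_map_C_le (P : Ideal B[X]) [P.IsPrime] (p : Ideal B) (hp : p = P.comap Polynomial.C)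
    (h : P = p.map Polynomial.C) : P.height ≤ p.height := by
  have hlo : P.LiesOver p := ⟨hp⟩
  have : p.IsPrime := by rw [hp]; infer_instance
  have h1 := Ideal.height_le_height_add_of_liesOver p P
  have : P.map (Ideal.Quotient.mk (p.map (algebraMap B B[X]))) = ⊥ := by
    rw [Ideal.map_eq_bot_iff_le_ker, Ideal.mk_ker]
    exact h.le
  rw [this] at h1
  have hne : Nontrivial (B[X] ⧸ p.map (algebraMap B B[X])) := by
    apply Ideal.Quotient.nontrivial_iff.2
    show p.map Polynomial.C ≠ ⊤
    rw [← h]; exact Ideal.IsPrime.ne_top ‹_›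
  rwa [Ideal.height_bot, add_zero] at h1

lemma regL_map_C (I : Ideal B) (b : List B) (h : RegL I b) :
    RegL (I.map Polynomial.C) (b.map Polynomial.C) := by
  induction b generalizing I with
  | nil => trivial
  | cons x b ih =>
    refine ⟨fun a ha => ?_, ?_⟩
    · rw [Ideal.mem_map_C_iff] at ha ⊢
      intro n
      have := ha n
      rw [Polynomial.coeff_C_mul] at this
      exact h.1 _ this
    · have := ih _ h.2
      rwa [Ideal.map_sup, Ideal.map_span, Set.image_singleton] at this

lemma map_ofList_C (b : List B) :
    (Ideal.ofList b).map Polynomial.C = Ideal.ofList (b.map Polynomial.C) := by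
  rw [Ideal.map_ofList]

lemma comap_map_C (q : Ideal B) : (q.map (Polynomial.C : B →+* B[X])).comap Polynomial.C = q := by
  ext x
  rw [Ideal.mem_comap, Ideal.mem_map_C_iff]
  constructor
  · intro h
    simpa using h 0
  · intro h n
    rw [Polynomial.coeff_C]
    split_ifs
    · exact h
    · exact q.zero_mem

lemma cm_poly (hB : CM B) : CM B[X] := by
  classical
  intro rs hrs P hP
  by_contra hlt
  rw [not_le] at hlt
  have hPp := hP.1
  obtain ⟨z, hz⟩ := hP.2
  have hrP : ∀ x ∈ rs, x ∈ P := fun x hx => assoc_le hP (Ideal.subset_span hx)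
  suffices h : ∃ xs : List B[X], RegL ⊥ xs ∧ (∀ x ∈ xs, x ∈ P) ∧ rs.length < xs.length by
    obtain ⟨xs, hxs, hxP, hlen⟩ := h
    have := grade_lemma P xs rs hxs hrs hxP hrP hlen z (fun a ha => (hz a).1 ha)
    apply hPp.ne_top
    rw [Ideal.eq_top_iff_one, hz, one_mul]
    exact this
  set q := P.comap (Polynomial.C : B →+* B[X]) with hq
  have hqp : q.IsPrime := by rw [hq]; infer_instance
  obtain ⟨m, hm⟩ := ENat.ne_top_iff_exists.1 (q.height_ne_top hqp.ne_top)
  obtain ⟨b, hbl, hbr, hbq⟩ := exists_reg_in hB q m (fun p hp hle => by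
    rw [hm]; exact Ideal.height_mono hle)
  have hbr' : RegL ⊥ (b.map (Polynomial.C : B →+* B[X])) := by
    have := regL_map_C ⊥ b hbr
    rwa [Ideal.map_bot] at this
  have hbP : ∀ x ∈ b.map (Polynomial.C : B →+* B[X]), x ∈ P := by
    intro x hx
    obtain ⟨y, hy, rfl⟩ := List.mem_map.1 hx
    exact hbq y hy
  by_cases hPq : P = q.map Polynomial.C
  · refine ⟨_, hbr', hbP, ?_⟩
    have := lt_of_lt_of_le hlt (height_map_C_le P q rfl hPq)
    rw [← hm] at this
    norm_cast at this
    simpa [hbl] using this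
  · obtain ⟨f, hfP, hf⟩ := coset_avoid
      ((assoc_finite (Ideal.ofList b)).toFinset.image (fun q => q.map (Polynomial.C : B →+* B[X])))
      (by
        intro p hp
        obtain ⟨q', hq', rfl⟩ := Finset.mem_image.1 hp
        have := ((assoc_finite _).mem_toFinset.1 hq').1
        exact Ideal.isPrime_map_C_of_isPrime) 0 P (by
        intro p hp hle
        obtain ⟨q', hq', rfl⟩ := Finset.mem_image.1 hp
        have hq'' := (assoc_finite _).mem_toFinset.1 hq'
        have hle' : P ≤ q'.map Polynomial.C := le_sup_right.trans hle
        have h1 : q ≤ q' := by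
          rw [← comap_map_C q']
          exact Ideal.comap_mono hle'
        have h2 := hB b hbr q' hq''
        rw [hbl, hm] at h2
        have h3 := Ideal.eq_of_le_of_height_le q h1 h2
        apply hPq
        refine le_antisymm (h3 ▸ hle') ?_
        rw [Ideal.map_le_iff_le_comap])
    refine ⟨b.map Polynomial.C ++ [f], ?_, ?_, ?_⟩
    · rw [regL_snoc, bot_sup_eq, ← map_ofList_C]
      refine ⟨hbr', fun a ha => ?_⟩
      set I := Ideal.ofList b with hI
      have hnz : f.map (Ideal.Quotient.mk I) ∈ nonZeroDivisors (B ⧸ I)[X] := by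
        rw [Polynomial.mem_nonZeroDivisors_iff]
        intro c hc
        obtain ⟨c, rfl⟩ := Ideal.Quotient.mk_surjective c
        by_contra hc0
        rw [Ideal.Quotient.eq_zero_iff_mem] at hc0
        obtain ⟨q', hq', hle⟩ := exists_assoc I c hc0
        apply hf (q'.map Polynomial.C)
          (Finset.mem_image.2 ⟨q', (assoc_finite _).mem_toFinset.2 hq', rfl⟩)
        rw [zero_add, Ideal.mem_map_C_iff]
        intro n
        apply hle
        have := congrArg (fun p => Polynomial.coeff p n) hc
        simp only [Polynomial.coeff_smul, Polynomial.coeff_map, smul_eq_mul, ← map_mul,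
          Polynomial.coeff_zero] at this
        rw [Ideal.Quotient.eq_zero_iff_mem] at this
        rwa [mul_comm]
      have hmem : ∀ w : B[X], w ∈ I.map Polynomial.C ↔ w.map (Ideal.Quotient.mk I) = 0 := by
        intro w
        rw [Ideal.mem_map_C_iff, Polynomial.ext_iff]
        refine forall_congr' fun n => ?_
        rw [Polynomial.coeff_map, Polynomial.coeff_zero, Ideal.Quotient.eq_zero_iff_mem]
      rw [hmem, Polynomial.map_mul] at ha
      rw [hmem]
      exact (mul_left_mem_nonZeroDivisors_eq_zero_iff hnz).1 ha
    · intro x hx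
      rcases List.mem_append.1 hx with h | h
      · exact hbP x h
      · rw [List.mem_singleton] at h; rwa [h]
    · have := lt_of_lt_of_le hlt (height_poly_le P q rfl)
      rw [← hm] at this
      norm_cast at this
      simpa [hbl] using this

end poly

lemma regL_equiv {B B' : Type} [CommRing B] [CommRing B'] (e : B ≃+* B') (I : Ideal B) (b : List B)
    (h : RegL I b) : RegL (I.comap e.symm) (b.map e) := by
  induction b generalizing I with
  | nil => trivial
  | cons x b ih =>
    refine ⟨fun a ha => ?_, ?_⟩
    · rw [Ideal.mem_comap] at ha ⊢
      rw [map_mul] at ha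
      exact h.1 _ (by simpa using ha)
    · have := ih _ h.2
      rwa [Ideal.comap_symm, Ideal.map_sup, Ideal.map_span, Set.image_singleton, ← Ideal.comap_symm] at this

lemma cm_equiv {B B' : Type} [CommRing B] [CommRing B'] (e : B ≃+* B') (h : CM B) : CM B' := by
  intro rs hrs p hp
  have h1 : RegL ⊥ (rs.map e.symm) := by
    have := regL_equiv e.symm ⊥ rs hrs
    rwa [Ideal.comap_symm, Ideal.map_bot] at this
  have hmem : ∀ a : B, a ∈ Ideal.ofList (rs.map e.symm) ↔ e a ∈ Ideal.ofList rs := by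
    intro a
    have := Ideal.map_ofList (e.symm : B' →+* B) rs
    rw [show rs.map e.symm = rs.map (e.symm : B' →+* B) from rfl, ← this]
    exact (Ideal.ext_iff.1 (Ideal.map_symm (I := Ideal.ofList rs) e) a)
  have h2 := h _ h1 (p.comap e) ⟨by have := hp.1; infer_instance, by
    obtain ⟨z, hz⟩ := hp.2
    refine ⟨e.symm z, fun a => ?_⟩
    rw [hmem, Ideal.mem_comap, hz]
    simp⟩
  rw [e.height_comap] at h2
  simpa using h2

lemma cm_mvPolynomial (k : Type) [Field k] (n : ℕ) : CM (MvPolynomial (Fin n) k) := by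
  induction n with
  | zero => exact cm_equiv (MvPolynomial.isEmptyRingEquiv k (Fin 0)).symm (cm_field k)
  | succ n ih => exact cm_equiv (MvPolynomial.finSuccEquiv k n).symm.toRingEquiv (cm_poly ih)

end ACI

namespace ACI

/-- Flat dimension at most `d`, expressed via injective dimension of the character module. -/
def FD (R : Type) [CommRing R] (d : ℕ) (M : Type) [AddCommGroup M] [Module R M] : Prop :=
  HasInjectiveDimensionLE (ModuleCat.of R (CharacterModule M)) d

section
variable {R : Type} [CommRing R]
variable {M N K : Type} [AddCommGroup M] [Module R M] [AddCommGroup N] [Module R N]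
  [AddCommGroup K] [Module R K]

lemma FD.mono {d e : ℕ} (h : FD R d M) (hde : d ≤ e) : FD R e M := by
  have : HasInjectiveDimensionLT (ModuleCat.of R (CharacterModule M)) (d + 1) := h
  exact hasInjectiveDimensionLT_of_ge _ (d + 1) (e + 1) (by omega)

lemma FD.of_equiv {d : ℕ} (e : M ≃ₗ[R] N) (h : FD R d M) : FD R d N := by
  have : HasInjectiveDimensionLT (ModuleCat.of R (CharacterModule M)) (d + 1) := h
  exact hasInjectiveDimensionLT_of_iso (CharacterModule.congr e).toModuleIso (d + 1)

lemma fd_zero_iff : FD R 0 M ↔ Module.Flat R M := by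
  rw [Module.Flat.iff_characterModule_injective]
  unfold FD HasInjectiveDimensionLE
  rw [zero_add, ← injective_iff_hasInjectiveDimensionLT_one]
  exact (Module.injective_iff_injective_object R (CharacterModule M)).symm

/-- The dual short exact sequence. -/
lemma dual_ses (f : K →ₗ[R] M) (g : M →ₗ[R] N) (hf : Function.Injective f)
    (hg : Function.Surjective g) (hfg : Function.Exact f g) :
    ∃ S : ShortComplex (ModuleCat.{0} R), S.ShortExact ∧
      S.X₁ = ModuleCat.of R (CharacterModule N) ∧ S.X₂ = ModuleCat.of R (CharacterModule M) ∧
      S.X₃ = ModuleCat.of R (CharacterModule K) := by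
  have hz : (CharacterModule.dual f).comp (CharacterModule.dual g) = 0 := by
    rw [← CharacterModule.dual_comp, hfg.linearMap_comp_eq_zero, CharacterModule.dual_zero]
  refine ⟨ShortComplex.mk (ModuleCat.ofHom (CharacterModule.dual g))
    (ModuleCat.ofHom (CharacterModule.dual f)) (by
      rw [← ModuleCat.ofHom_comp, hz]; rfl), ?_, rfl, rfl, rfl⟩
  refine ShortComplex.ShortExact.mk' ?_ ?_ ?_
  · rw [ShortComplex.moduleCat_exact_iff]
    intro c hc
    change CharacterModule M at c
    have hc' : ∀ x, c (f x) = 0 := fun x => DFunLike.congr_fun hc x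
    let s := Function.surjInv hg
    have key : ∀ m, c (s (g m)) = c m := by
      intro m
      have : g (s (g m) - m) = 0 := by
        rw [map_sub, Function.surjInv_eq hg, sub_self]
      obtain ⟨x, hx⟩ := (hfg _).1 this
      have h2 := hc' x
      rw [hx, map_sub, sub_eq_zero] at h2
      exact h2
    refine ⟨(AddMonoidHom.mk' (fun n => c (s n)) ?_ : N →+ AddCircle (1 : ℚ)), ?_⟩
    · intro a b
      obtain ⟨a, rfl⟩ := hg a
      obtain ⟨b, rfl⟩ := hg b
      rw [← map_add, key, key, key, map_add]
    · apply CharacterModule.ext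
      exact key
  · rw [ModuleCat.mono_iff_injective]
    exact CharacterModule.dual_injective_of_surjective g hg
  · rw [ModuleCat.epi_iff_surjective]
    exact CharacterModule.dual_surjective_of_injective f hf

/-- Quotient estimate. -/
lemma FD.quot {d : ℕ} (f : K →ₗ[R] M) (g : M →ₗ[R] N) (hf : Function.Injective f)
    (hg : Function.Surjective g) (hfg : Function.Exact f g)
    (hK : FD R d K) (hM : FD R (d + 1) M) : FD R (d + 1) N := by
  obtain ⟨S, hS, h1, h2, h3⟩ := dual_ses f g hf hg hfg
  unfold FD HasInjectiveDimensionLE at *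
  rw [← h3] at hK
  rw [← h2] at hM
  rw [← h1]
  exact hS.hasInjectiveDimensionLT_X₁ _ hK hM

/-- Submodule estimate. -/
lemma FD.sub {d : ℕ} (f : K →ₗ[R] M) (g : M →ₗ[R] N) (hf : Function.Injective f)
    (hg : Function.Surjective g) (hfg : Function.Exact f g)
    (hM : FD R d M) (hN : FD R (d + 1) N) : FD R d K := by
  obtain ⟨S, hS, h1, h2, h3⟩ := dual_ses f g hf hg hfg
  unfold FD HasInjectiveDimensionLE at *
  rw [← h2] at hM
  rw [← h1] at hN
  rw [← h3]
  exact hS.hasInjectiveDimensionLT_X₃ _ hM hN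

/-- Extension estimate. -/
lemma FD.ext {d : ℕ} (f : K →ₗ[R] M) (g : M →ₗ[R] N) (hf : Function.Injective f)
    (hg : Function.Surjective g) (hfg : Function.Exact f g)
    (hK : FD R d K) (hN : FD R d N) : FD R d M := by
  obtain ⟨S, hS, h1, h2, h3⟩ := dual_ses f g hf hg hfg
  unfold FD HasInjectiveDimensionLE at *
  rw [← h1] at hN
  rw [← h3] at hK
  rw [← h2]
  exact hS.hasInjectiveDimensionLT_X₂ _ hN hK

lemma FD.prod {d : ℕ} (hM : FD R d M) (hN : FD R d N) : FD R d (M × N) :=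
  FD.ext (LinearMap.inl R M N) (LinearMap.snd R M N) LinearMap.inl_injective
    LinearMap.snd_surjective (by
      intro x
      constructor
      · intro h; exact ⟨x.1, Prod.ext rfl h.symm⟩
      · rintro ⟨y, rfl⟩; rfl) hM hN

lemma FD.of_flat (d : ℕ) [Module.Flat R M] : FD R d M :=
  (fd_zero_iff.2 ‹_›).mono (Nat.zero_le d)

lemma FD.of_subsingleton (d : ℕ) [Subsingleton M] : FD R d M := FD.of_flat d

/-- Free covers. -/
lemma exists_cover (A : Type) [CommRing A] (N : Type) [AddCommGroup N] [Module A N] :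
    ∃ (K F : Type) (_ : AddCommGroup K) (_ : Module A K) (_ : AddCommGroup F) (_ : Module A F)
      (f : K →ₗ[A] F) (g : F →ₗ[A] N), Module.Flat A F ∧ Function.Injective f ∧
      Function.Surjective g ∧ Function.Exact f g := by
  let g : (N →₀ A) →ₗ[A] N := Finsupp.linearCombination A id
  refine ⟨LinearMap.ker g, N →₀ A, inferInstance, inferInstance, inferInstance, inferInstance,
    (LinearMap.ker g).subtype, g, inferInstance, (LinearMap.ker g).injective_subtype,
    Finsupp.linearCombination_id_surjective A N, ?_⟩
  rw [LinearMap.exact_iff, Submodule.range_subtype]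

/-- Base change along a flat algebra. -/
lemma FD.baseChange {A : Type} [CommRing A] [Algebra A R] [Module.Flat A R] {d : ℕ}
    {N : Type} [AddCommGroup N] [Module A N]
    (h : FD A d N) : FD R d (TensorProduct A R N) := by
  induction d generalizing N with
  | zero =>
    have : Module.Flat A N := fd_zero_iff.1 h
    exact FD.of_flat 0
  | succ d ih =>
    obtain ⟨K, F, _, _, _, _, f, g, hF, hf, hg, hex⟩ := exists_cover A N
    have hK : FD A d K := FD.sub f g hf hg hex (FD.of_flat d) h
    refine FD.quot (f.baseChange R) (g.baseChange R) ?_ ?_ ?_ (ih hK) (FD.of_flat (d + 1))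
    · exact Module.Flat.lTensor_preserves_injective_linearMap _ hf
    · exact LinearMap.lTensor_surjective R hg
    · exact lTensor_exact R hex hg

/-- Quotients by ideals. -/
lemma FD.quotIdeal {d : ℕ} {I : Ideal R} (h : FD R d I) : FD R (d + 1) (R ⧸ I) :=
  FD.quot I.subtype I.mkQ I.injective_subtype I.mkQ_surjective (by
    rw [LinearMap.exact_iff, Submodule.range_subtype, Submodule.ker_mkQ]) h (FD.of_flat _)

/-- Splicing a projective resolution of a first syzygy. -/
lemma splice {X Y Z : ModuleCat.{0} R} (f : X ⟶ Y) (g : Y ⟶ Z) (w : f ≫ g = 0)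
    (hS : (ShortComplex.mk f g w).ShortExact) [Projective Y] (P : ProjectiveResolution X) :
    ∃ Q : ProjectiveResolution Z, ∀ i, Limits.IsZero (P.complex.X i) →
      Limits.IsZero (Q.complex.X (i + 1)) := by
  have hm : Mono f := hS.mono_f
  have he : Epi g := hS.epi_g
  obtain ⟨p0, hp0, hepi, hp0ex⟩ : ∃ (p0 : P.complex.X 0 ⟶ X) (hp0 : P.complex.d 1 0 ≫ p0 = 0),
      Epi p0 ∧ (ShortComplex.mk _ _ hp0).Exact :=
    ⟨P.π.f 0, P.complex_d_comp_π_f_zero, inferInstanceAs (Epi (P.π.f 0)),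
      ShortComplex.exact_of_g_is_cokernel (ShortComplex.mk _ _ P.complex_d_comp_π_f_zero)
      P.isColimitCokernelCofork⟩
  let φ : P.complex.X 0 ⟶ Y := p0 ≫ f
  have hφ : P.complex.d 1 0 ≫ φ = 0 := by
    show P.complex.d 1 0 ≫ (p0 ≫ f) = 0
    rw [← Category.assoc, hp0, Limits.zero_comp]
  let C := P.complex.augment φ hφ
  have hd10 : C.d 1 0 ≫ g = 0 := by
    show (p0 ≫ f) ≫ g = 0
    rw [Category.assoc, w, Limits.comp_zero]
  let π : C ⟶ (ChainComplex.single₀ _).obj Z :=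
    (ChainComplex.toSingle₀Equiv C Z).symm ⟨g, hd10⟩
  have hex0 : (ShortComplex.mk _ _ hd10).Exact := by
    rw [ShortComplex.moduleCat_exact_iff]
    intro y hy
    obtain ⟨x, hx⟩ := (ShortComplex.moduleCat_exact_iff _).1 hS.exact y hy
    obtain ⟨p, rfl⟩ := (ModuleCat.epi_iff_surjective _).1 hepi x
    exact ⟨p, hx⟩
  have hex1 : (ShortComplex.mk _ _ (C.d_comp_d 2 1 0)).Exact := by
    rw [ShortComplex.moduleCat_exact_iff]
    intro y hy
    change P.complex.X 0 at y
    have hy' : f (p0 y) = 0 := hy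
    have h1 : p0 y = 0 := by
      apply (ModuleCat.mono_iff_injective f).1 hm
      rw [hy', map_zero]
    exact (ShortComplex.moduleCat_exact_iff _).1 hp0ex y h1
  have hexs : ∀ n, (ShortComplex.mk _ _ (C.d_comp_d (n + 3) (n + 2) (n + 1))).Exact := fun n =>
    P.exact_succ n
  have hat : ∀ n, C.ExactAt (n + 1) := by
    intro n
    rw [HomologicalComplex.exactAt_iff' _ (n + 2) (n + 1) n (by simp only [ChainComplex.prev]; rfl)
      (by simp)]
    cases n with
    | zero => exact hex1
    | succ n => exact hexs n
  refine ⟨{ complex := C, projective := ?_, π := π, quasiIso := ?_ }, ?_⟩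
  · intro n
    cases n with
    | zero => exact ‹Projective Y›
    | succ n => exact P.projective n
  · refine ⟨fun n => ?_⟩
    cases n with
    | zero =>
      rw [ChainComplex.quasiIsoAt₀_iff, ShortComplex.quasiIso_iff_of_zeros']
      · refine (ShortComplex.exact_and_epi_g_iff_of_iso ?_).2 ⟨hex0, he⟩
        refine ShortComplex.isoMk (Iso.refl _) (Iso.refl _) (Iso.refl _) ?_ ?_
        · exact (Category.id_comp _).trans (Category.comp_id _).symm
        · refine (Category.id_comp _).trans (Eq.trans ?_ (Category.comp_id _).symm)
          exact (ChainComplex.toSingle₀Equiv_symm_apply_f_zero (C := C) (X := Z) g hd10).symm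
      all_goals rfl
    | succ n =>
      rw [quasiIsoAt_iff_exactAt']
      · exact hat n
      · apply ChainComplex.exactAt_succ_single_obj
  · intro i hi
    exact hi

/-- Finite flat dimension gives a short projective resolution. -/
lemma exists_resolution [IsNoetherianRing R] (d : ℕ) (M : Type) [AddCommGroup M] [Module R M]
    [Module.Finite R M] (h : FD R d M) :
    ∃ P : ProjectiveResolution (ModuleCat.of R M),
      ∀ i, d < i → Limits.IsZero (P.complex.X i) := by
  induction d generalizing M with
  | zero =>
    have hfl : Module.Flat R M := fd_zero_iff.1 h
    have hpr : Module.Projective R M := by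
      have := Module.finitePresentation_of_finite R M
      exact Module.Flat.projective_of_finitePresentation
    have : Projective (ModuleCat.of R M) := ModuleCat.projective_of_categoryTheory_projective _
    refine ⟨ProjectiveResolution.self _, fun i hi => ?_⟩
    apply HomologicalComplex.isZero_single_obj_X
    omega
  | succ d ih =>
    obtain ⟨n, g, hg⟩ := Module.Finite.exists_fin' R M
    let K := LinearMap.ker g
    have hex : Function.Exact K.subtype g := by
      rw [LinearMap.exact_iff, Submodule.range_subtype]
    have hK : FD R d K := FD.sub K.subtype g K.injective_subtype hg hex (FD.of_flat d) h
    obtain ⟨P, hP⟩ := ih K hK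
    have : Projective (ModuleCat.of R (Fin n → R)) := ModuleCat.projective_of_categoryTheory_projective _
    have w : ModuleCat.ofHom K.subtype ≫ ModuleCat.ofHom g = 0 := by
      rw [← ModuleCat.ofHom_comp, hex.linearMap_comp_eq_zero]; rfl
    obtain ⟨Q, hQ⟩ := splice (ModuleCat.ofHom K.subtype) (ModuleCat.ofHom g) w
      (ShortComplex.ShortExact.mk' (by
        rw [ShortComplex.moduleCat_exact_iff]
        intro y hy
        exact (hex y).1 hy) (by
        rw [ModuleCat.mono_iff_injective]; exact K.injective_subtype) (by
        rw [ModuleCat.epi_iff_surjective]; exact hg)) P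
    refine ⟨Q, fun i hi => ?_⟩
    obtain ⟨j, rfl⟩ : ∃ j, i = j + 1 := ⟨i - 1, by omega⟩
    exact hQ j (hP j (by omega))

end
end ACI

namespace ACI
open TensorProduct in
/-- Passing from `B` to `B[X]` raises flat dimension by at most one. -/
lemma poly_step {B A : Type} [CommRing B] [CommRing A] [Algebra B A] (e : Polynomial B ≃ₐ[B] A)
    {M : Type} [AddCommGroup M] [Module A M] [Module B M] [IsScalarTower B A M] {d : ℕ}
    (h : FD B d M) : FD A (d + 1) M := by
  let x : A := e Polynomial.X
  let b := (Polynomial.basisMonomials B).map e.toLinearEquiv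
  have hfree : Module.Free B A := Module.Free.of_basis b
  let μ : M →ₗ[B] M := Algebra.lsmul B B M x
  have hμ : ∀ m, μ m = x • m := fun m => rfl
  let f : A ⊗[B] M →ₗ[A] A ⊗[B] M := x • LinearMap.id - μ.baseChange A
  have hf : ∀ a m, f (a ⊗ₜ m) = (x * a) ⊗ₜ m - a ⊗ₜ (x • m) := fun a m => rfl
  let g : A ⊗[B] M →ₗ[A] M := LinearMap.liftBaseChange A (LinearMap.id : M →ₗ[B] M)
  have hg : ∀ a m, g (a ⊗ₜ m) = a • m := fun a m => by
    simp [g, LinearMap.liftBaseChange_tmul]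
  have hgf : ∀ z, g (f z) = 0 := by
    intro z
    induction z with
    | zero => simp
    | add z w hz hw => rw [map_add, map_add, hz, hw, add_zero]
    | tmul a m => rw [hf, map_sub, hg, hg, smul_smul, mul_comm, sub_self]
  have hP : ∀ p : Polynomial B, ∀ m : M, (e p) ⊗ₜ[B] m - (1 : A) ⊗ₜ[B] (e p • m) ∈
      LinearMap.range f := by
    intro p
    induction p using Polynomial.induction_on with
    | C a =>
      intro m
      have : e (Polynomial.C a) = a • (1 : A) := by
        rw [← Algebra.algebraMap_eq_smul_one]; exact e.commutes a
      rw [this, smul_tmul, smul_assoc, one_smul, sub_self]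
      exact zero_mem _
    | add p q hp hq =>
      intro m
      have := add_mem (hp m) (hq m)
      convert this using 1
      rw [map_add, add_tmul, add_smul, tmul_add]; abel
    | monomial n a ih =>
      intro m
      have h1 := ih (x • m)
      have h2 : f (e (Polynomial.C a * Polynomial.X ^ n) ⊗ₜ m) ∈ LinearMap.range f := ⟨_, rfl⟩
      have := add_mem h1 h2
      convert this using 1
      rw [hf, smul_smul, show e (Polynomial.C a * Polynomial.X ^ (n + 1)) =
        x * e (Polynomial.C a * Polynomial.X ^ n) by
          rw [← map_mul]; congr 1; ring, mul_comm x]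
      abel
  have hex : Function.Exact f g := by
    intro z
    refine ⟨fun hz => ?_, fun ⟨w, hw⟩ => hw ▸ hgf w⟩
    have key : ∀ z, z - (1 : A) ⊗ₜ[B] g z ∈ LinearMap.range f := by
      intro z
      induction z with
      | zero => simp
      | add z w hz hw =>
        have := add_mem hz hw
        convert this using 1
        rw [map_add, tmul_add]; abel
      | tmul a m =>
        obtain ⟨p, rfl⟩ := e.surjective a
        rw [hg]; exact hP p m
    have := key z
    rw [hz, tmul_zero, sub_zero] at this
    exact this
  let E := TensorProduct.equivFinsuppOfBasisLeft (N := M) b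
  have hE : ∀ a m i, E (a ⊗ₜ m) i = (e.symm a).coeff i • m := by
    intro a m i
    simp [E, TensorProduct.equivFinsuppOfBasisLeft_apply_tmul_apply, b]
    rfl
  have hE1 : ∀ z i, E (x • z) (i + 1) = E z i := by
    intro z i
    induction z with
    | zero => simp
    | add z w hz hw =>
      rw [smul_add, map_add E, map_add E, Finsupp.add_apply, Finsupp.add_apply, hz, hw]
    | tmul a m =>
      rw [smul_tmul', hE, hE]
      congr 1
      rw [smul_eq_mul, map_mul]
      simp [x]
  have hE2 : ∀ z i, E (μ.baseChange A z) i = x • E z i := by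
    intro z i
    induction z with
    | zero => simp
    | add z w hz hw => rw [map_add, map_add, map_add, Finsupp.add_apply, Finsupp.add_apply, hz, hw,
        smul_add]
    | tmul a m =>
      rw [LinearMap.baseChange_tmul, hE, hE, hμ, smul_comm]
  have hinj : Function.Injective f := by
    rw [injective_iff_map_eq_zero]
    intro z hz
    have h1 : x • z = μ.baseChange A z := sub_eq_zero.1 hz
    have h2 : ∀ i, E z i = x • E z (i + 1) := fun i => by rw [← hE1, h1, hE2]
    have h3 : ∀ j i, E z i = x ^ j • E z (i + j) := by
      intro j
      induction j with
      | zero => intro i; simp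
      | succ j ih => intro i; rw [ih, h2, smul_smul, ← pow_succ, add_assoc]
    rw [← E.map_eq_zero_iff]
    ext i
    rw [h3 ((E z).support.sup id + 1) i, Finsupp.notMem_support_iff.1, smul_zero]
    · rfl
    · intro hm
      have := Finset.le_sup (f := id) hm
      simp only [id] at this
      omega
  exact FD.quot f g hinj (fun m => ⟨1 ⊗ₜ m, by rw [hg, one_smul]⟩) hex (FD.baseChange h)
    ((FD.baseChange h).mono (Nat.le_succ d))

open TensorProduct in
/-- Flat over `B` implies flat dimension at most `m` over a polynomial ring in `m` variables. -/
lemma fd_mvpoly (m : ℕ) {B A : Type} [CommRing B] [CommRing A] [Algebra B A]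
    (e : MvPolynomial (Fin m) B ≃ₐ[B] A)
    {M : Type} [AddCommGroup M] [Module A M] [Module B M] [IsScalarTower B A M]
    (h : Module.Flat B M) : FD A m M := by
  induction m generalizing A M with
  | zero =>
    let e' : B ≃ₐ[B] A := ((MvPolynomial.isEmptyAlgEquiv B (Fin 0)).symm.trans e)
    have hc : ∀ b : B, e' b = algebraMap B A b := fun b => e'.commutes b
    have hsurj : Function.Surjective (algebraMap B A) := fun a => ⟨e'.symm a, by rw [← hc]; simp⟩
    refine fd_zero_iff.2 ?_
    let μ : A ⊗[B] M →ₗ[A] M := LinearMap.liftBaseChange A (LinearMap.id : M →ₗ[B] M)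
    have hμ : ∀ a m, μ (a ⊗ₜ m) = a • m := fun a m => by
      simp [μ, LinearMap.liftBaseChange_tmul]
    have hz : ∀ z : A ⊗[B] M, z = 1 ⊗ₜ μ z := by
      intro z
      induction z with
      | zero => simp
      | add z w hz hw => rw [map_add, TensorProduct.tmul_add, ← hz, ← hw]
      | tmul a m =>
        obtain ⟨b, rfl⟩ := hsurj a
        rw [hμ, algebraMap_smul, ← TensorProduct.smul_tmul, Algebra.algebraMap_eq_smul_one]
    have : Function.Bijective μ := by
      refine ⟨?_, fun m => ⟨1 ⊗ₜ m, by rw [hμ, one_smul]⟩⟩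
      rw [injective_iff_map_eq_zero]
      intro z h0
      rw [hz z, h0, TensorProduct.tmul_zero]
    exact Module.Flat.of_linearEquiv (LinearEquiv.ofBijective μ this).symm
  | succ m ih =>
    let e' : Polynomial (MvPolynomial (Fin m) B) ≃ₐ[B] A :=
      (MvPolynomial.finSuccEquiv B m).symm.trans e
    letI : Algebra (MvPolynomial (Fin m) B) A :=
      (e'.toRingEquiv.toRingHom.comp Polynomial.C).toAlgebra
    letI : Module (MvPolynomial (Fin m) B) M := Module.compHom M
      (algebraMap (MvPolynomial (Fin m) B) A)
    have : IsScalarTower (MvPolynomial (Fin m) B) A M := ⟨fun x y z => by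
      rw [Algebra.smul_def, mul_smul]; rfl⟩
    have : IsScalarTower B (MvPolynomial (Fin m) B) M := ⟨fun x y z => by
      have : algebraMap (MvPolynomial (Fin m) B) A (x • y) =
        x • algebraMap (MvPolynomial (Fin m) B) A y := by
        show e' (Polynomial.C (x • y)) = x • e' (Polynomial.C y)
        rw [← Polynomial.smul_C, map_smul]
      show algebraMap (MvPolynomial (Fin m) B) A (x • y) • z =
        x • (algebraMap (MvPolynomial (Fin m) B) A y • z)
      rw [this, smul_assoc]⟩
    have h1 : FD (MvPolynomial (Fin m) B) m M := ih AlgEquiv.refl h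
    let e'' : Polynomial (MvPolynomial (Fin m) B) ≃ₐ[MvPolynomial (Fin m) B] A :=
      AlgEquiv.ofRingEquiv (f := e'.toRingEquiv) (fun r => rfl)
    exact poly_step e'' h1

/-- Hilbert's syzygy theorem (flat version). -/
lemma fd_field {k : Type} [Field k] (t : ℕ) (M : Type) [AddCommGroup M]
    [Module (MvPolynomial (Fin t) k) M] : FD (MvPolynomial (Fin t) k) t M := by
  letI : Module k M := Module.compHom M (algebraMap k (MvPolynomial (Fin t) k))
  have : IsScalarTower k (MvPolynomial (Fin t) k) M := ⟨fun x y z => by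
      rw [Algebra.smul_def, mul_smul]; rfl⟩
  exact fd_mvpoly t AlgEquiv.refl inferInstance

/-- Torsion free over one of the variables lowers the bound by one. -/
lemma fd_torsionfree {k : Type} [Field k] (t : ℕ) (i : Fin (t + 1)) (M : Type) [AddCommGroup M]
    [Module (MvPolynomial (Fin (t + 1)) k) M]
    (hM : ∀ s : Polynomial k, s ≠ 0 → ∀ m : M,
      (Polynomial.aeval (X i : MvPolynomial (Fin (t + 1)) k) s) • m = 0 → m = 0) :
    FD (MvPolynomial (Fin (t + 1)) k) t M := by
  let A := MvPolynomial (Fin (t + 1)) k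
  let φ : Polynomial k →ₐ[k] A := Polynomial.aeval (X i : A)
  letI : Algebra (Polynomial k) A := φ.toRingHom.toAlgebra
  letI : Module (Polynomial k) M := Module.compHom M φ.toRingHom
  have : IsScalarTower (Polynomial k) A M := ⟨fun x y z => by
      rw [Algebra.smul_def, mul_smul]; rfl⟩
  let e0 : MvPolynomial (Fin t) (Polynomial k) ≃ₐ[k] A :=
    (MvPolynomial.optionEquivRight k (Fin t)).symm.trans
      (MvPolynomial.renameEquiv k (finSuccEquiv' i).symm)
  have he0 : ∀ r : Polynomial k, e0 (MvPolynomial.C r) = φ r := by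
    intro r
    have : (e0.toAlgHom.comp
      (IsScalarTower.toAlgHom k (Polynomial k) (MvPolynomial (Fin t) (Polynomial k)))) = φ := by
      ext1
      have : (MvPolynomial.optionEquivRight k (Fin t)).symm (MvPolynomial.C Polynomial.X)
         = X none := by
        rw [AlgEquiv.symm_apply_eq, MvPolynomial.optionEquivRight_X_none]
      have h2 : (MvPolynomial.renameEquiv k (finSuccEquiv' i).symm) (X none) = X i := by
        rw [MvPolynomial.renameEquiv_apply, MvPolynomial.rename_X, finSuccEquiv'_symm_none]
      simp [e0, φ, MvPolynomial.algebraMap_eq, this, h2]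
    exact DFunLike.congr_fun this r
  let e : MvPolynomial (Fin t) (Polynomial k) ≃ₐ[Polynomial k] A :=
    AlgEquiv.ofRingEquiv (f := e0.toRingEquiv) he0
  have hfl : Module.Flat (Polynomial k) M := by
    have : Module.IsTorsionFree (Polynomial k) M := by
      refine Module.IsTorsionFree.mk fun s hs => ?_
      have hs0 : s ≠ 0 := hs.ne_zero
      intro a b hab
      have : φ s • (a - b) = 0 := by
        rw [smul_sub]; exact sub_eq_zero.2 hab
      exact sub_eq_zero.1 (hM s hs0 _ this)
    infer_instance
  exact fd_mvpoly t e hfl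
end ACI

namespace ACI

lemma indep {k R κ : Type} [Field k] [CommRing R] [Algebra k R] (t : ℕ) (h : Fin t → R)
    (I : Ideal R) (hreg : RegL I (List.ofFn h)) (b : κ → R)
    (hb : ∀ (s : Finset κ) (c : κ → k), ∑ e ∈ s, c e • b e ∈ I ⊔ Ideal.ofList (List.ofFn h) →
      ∀ e ∈ s, c e = 0)
    (s : Finset κ) (u : κ → MvPolynomial (Fin t) k)
    (hu : ∑ e ∈ s, aeval h (u e) * b e ∈ I) : ∀ e ∈ s, u e = 0 := by
  induction t generalizing I with
  | zero =>
    intro e he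
    have h0 : ∀ e, u e = C (coeff 0 (u e)) := fun e => eq_C_of_isEmpty _
    have := hb s (fun e => coeff 0 (u e)) (by
      refine Ideal.mem_sup_left ?_
      convert hu using 2 with e
      conv_rhs => rw [h0 e]
      rw [aeval_C, Algebra.smul_def]) e he
    rw [h0 e, this, map_zero]
  | succ t ih =>
    rw [List.ofFn_succ] at hreg hb
    obtain ⟨hnz, hreg'⟩ := hreg
    let h' : Fin t → R := fun i => h i.succ
    let ev : Polynomial (MvPolynomial (Fin t) k) →+* R :=
      Polynomial.eval₂RingHom (aeval h' : MvPolynomial (Fin t) k →ₐ[k] R).toRingHom (h 0)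
    have hev : ∀ p : MvPolynomial (Fin (t + 1)) k, aeval h p = ev (finSuccEquiv k t p) := by
      intro p
      induction p using MvPolynomial.induction_on with
      | C a => simp [ev, finSuccEquiv_apply]
      | add p q hp hq => rw [map_add, map_add, map_add, hp, hq]
      | mul_X p i hp =>
        rw [map_mul, map_mul, map_mul, hp]
        congr 1
        refine Fin.cases ?_ (fun i => ?_) i
        · rw [finSuccEquiv_X_zero]; simp [ev]
        · rw [finSuccEquiv_X_succ]; simp [ev, h']
    have key : ∀ N (v : κ → Polynomial (MvPolynomial (Fin t) k)),
        (∀ e ∈ s, (v e).natDegree < N) → ∑ e ∈ s, ev (v e) * b e ∈ I → ∀ e ∈ s, v e = 0 := by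
      intro N
      induction N with
      | zero => intro v hv _ e he; exact absurd (hv e he) (by omega)
      | succ N ihN =>
        intro v hv hsum
        have hdec : ∀ e, ev (v e) = h 0 * ev ((v e).divX) + aeval h' ((v e).coeff 0) := by
          intro e
          conv_lhs => rw [← Polynomial.divX_mul_X_add (v e)]
          rw [map_add, map_mul]
          simp [ev, mul_comm]
        have hc : ∀ e ∈ s, (v e).coeff 0 = 0 := by
          refine ih h' (I ⊔ Ideal.span {h 0}) hreg' ?_ _ ?_
          · intro s c hc
            refine hb s c ?_
            rw [sup_assoc] at hc
            rwa [Ideal.ofList_cons]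
          · have h1 : ∑ e ∈ s, aeval h' ((v e).coeff 0) * b e =
              ∑ e ∈ s, ev (v e) * b e - h 0 * ∑ e ∈ s, ev ((v e).divX) * b e := by
              rw [Finset.mul_sum, ← Finset.sum_sub_distrib]
              refine Finset.sum_congr rfl fun e _ => ?_
              rw [hdec]; ring
            rw [h1]
            refine sub_mem (Ideal.mem_sup_left hsum) (Ideal.mem_sup_right ?_)
            exact Ideal.mul_mem_right _ _ (Ideal.mem_span_singleton_self _)
        have hd : ∀ e ∈ s, (v e).divX = 0 ∨ True := fun _ _ => Or.inr trivial
        by_cases hN : N = 0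
        · subst hN
          intro e he
          rw [Polynomial.eq_C_of_natDegree_eq_zero (Nat.lt_one_iff.1 (hv e he)), hc e he, map_zero]
        have hz := ihN (fun e => (v e).divX) (fun e he => by
          rw [Polynomial.natDegree_divX_eq_natDegree_tsub_one]
          have := hv e he
          omega) (by
          refine hnz _ ?_
          rw [Finset.mul_sum]
          convert hsum using 2 with e he
          rw [hdec, hc e he]; simp; ring)
        intro e he
        rw [← Polynomial.divX_mul_X_add (v e), hz e he, hc e he]; simp
    intro e he
    have := key (s.sup (fun e => (finSuccEquiv k t (u e)).natDegree) + 1)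
      (fun e => finSuccEquiv k t (u e))
      (fun e he => Nat.lt_succ_of_le
        (Finset.le_sup (f := fun e => (finSuccEquiv k t (u e)).natDegree) he))
      (by simpa only [hev] using hu) e he
    exact (map_eq_zero_iff _ (finSuccEquiv k t).injective).1 this

/-- A polynomial ring is free over the subalgebra generated by a regular sequence of forms. -/
lemma free_of_reg {k : Type} [Field k] {n t : ℕ}
    [Algebra (MvPolynomial (Fin t) k) (MvPolynomial (Fin n) k)]
    (h : Fin t → MvPolynomial (Fin n) k)
    (hφ : ∀ a, algebraMap (MvPolynomial (Fin t) k) (MvPolynomial (Fin n) k) a = aeval h a)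
    (hhom : ∀ i, ∃ d, 1 ≤ d ∧ (h i).IsHomogeneous d) (hreg : RegL ⊥ (List.ofFn h)) :
    Module.Free (MvPolynomial (Fin t) k) (MvPolynomial (Fin n) k) := by
  let R := MvPolynomial (Fin n) k
  let A := MvPolynomial (Fin t) k
  have hsm : ∀ (a : A) (r : R), a • r = aeval h a * r := fun a r => by
    rw [Algebra.smul_def, hφ]
  let I : Ideal R := Ideal.ofList (List.ofFn h)
  have hI : I = Ideal.span (Set.range h) := by
    show Ideal.span _ = _
    congr 1
    ext x; simp [List.mem_ofFn]
  let v : (Fin n →₀ ℕ) → R ⧸ I := fun m => Ideal.Quotient.mkₐ k I (monomial m 1)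
  obtain ⟨κ, a, ha, hspan, hli⟩ := exists_linearIndependent' k v
  let b : κ → R := fun e => monomial (a e) 1
  have hspan' : Submodule.span k (Set.range (v ∘ a)) = ⊤ := by
    rw [hspan, eq_top_iff]
    rintro x -
    obtain ⟨f, rfl⟩ := Ideal.Quotient.mkₐ_surjective k I x
    induction f using MvPolynomial.induction_on' with
    | monomial m c =>
      have : monomial m c = c • (monomial m 1 : MvPolynomial (Fin n) k) := by
        rw [smul_monomial, smul_eq_mul, mul_one]
      rw [this, map_smul]
      exact Submodule.smul_mem _ _ (Submodule.subset_span ⟨m, rfl⟩)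
    | add p q hp hq => rw [map_add]; exact add_mem hp hq
  have hdecomp : ∀ f : R, ∃ g ∈ Submodule.span k (Set.range b), f - g ∈ I := by
    intro f
    have h1 : Ideal.Quotient.mkₐ k I f ∈ Submodule.span k (Set.range (v ∘ a)) := by
      rw [hspan']; trivial
    have h2 : Set.range (v ∘ a) = (Ideal.Quotient.mkₐ k I).toLinearMap '' (Set.range b) := by
      rw [← Set.range_comp]; rfl
    rw [h2, ← Submodule.map_span] at h1
    obtain ⟨g, hg, hgf⟩ := h1
    refine ⟨g, hg, ?_⟩
    rw [← Ideal.Quotient.eq]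
    exact hgf.symm
  have hind : LinearIndependent A b := by
    rw [linearIndependent_iff']
    intro s u hu
    refine indep t h ⊥ hreg b ?_ s u ?_
    · intro s c hc
      refine linearIndependent_iff'.1 hli s c ?_
      rw [bot_sup_eq] at hc
      have : (Ideal.Quotient.mkₐ k I) (∑ e ∈ s, c e • b e) = 0 := Ideal.Quotient.eq_zero_iff_mem.2 hc
      rw [map_sum] at this
      simp only [map_smul] at this
      exact this
    · rw [Ideal.mem_bot]
      rw [← hu]
      exact Finset.sum_congr rfl fun e _ => (hsm _ _).symm
  let N : Submodule A R := Submodule.span A (Set.range b)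
  have hNk : ∀ (c : k) (r : R), r ∈ N → c • r ∈ N := by
    intro c r hr
    have : c • r = (C c : A) • r := by
      rw [hsm, aeval_C, Algebra.smul_def]
    rw [this]; exact N.smul_mem _ hr
  have hhomN : ∀ d (f : R), f.IsHomogeneous d → f ∈ N := by
    intro d
    induction d using Nat.strong_induction_on with
    | _ d ih =>
    intro f hf
    obtain ⟨g, hg, hfg⟩ := hdecomp f
    have hg' : homogeneousComponent d g ∈ N := by
      clear hfg
      induction hg using Submodule.span_induction with
      | mem x hx =>
        obtain ⟨e, rfl⟩ := hx
        rw [homogeneousComponent_of_mem (n := (a e).degree)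
          ((mem_homogeneousSubmodule _ _).2 (isHomogeneous_monomial _ rfl))]
        split_ifs
        · exact Submodule.subset_span ⟨e, rfl⟩
        · exact zero_mem _
      | zero => rw [map_zero]; exact zero_mem _
      | add x y _ _ hx hy => rw [map_add]; exact add_mem hx hy
      | smul c x _ hx => rw [map_smul]; exact hNk c _ hx
    have hr : ∀ (r : R) i, homogeneousComponent d (r * h i) ∈ N := by
      intro r i
      obtain ⟨di, hdi, hhi⟩ := hhom i
      rw [← sum_homogeneousComponent r, Finset.sum_mul, map_sum]
      refine Submodule.sum_mem _ fun j _ => ?_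
      rw [homogeneousComponent_of_mem (n := j + di)
        ((mem_homogeneousSubmodule _ _).2 ((homogeneousComponent_isHomogeneous j r).mul hhi))]
      split_ifs with hj
      · have h1 := ih j (by omega) _ (homogeneousComponent_isHomogeneous j r)
        have h2 := N.smul_mem (X i : A) h1
        rw [hsm, aeval_X, mul_comm] at h2
        exact h2
      · exact zero_mem _
    rw [hI, Ideal.mem_span_range_iff_exists_fun] at hfg
    obtain ⟨c, hc⟩ := hfg
    have h3 : homogeneousComponent d (f - g) ∈ N := by
      rw [← hc, map_sum]
      exact Submodule.sum_mem _ fun i _ => hr _ i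
    have h4 := add_mem h3 hg'
    rw [← map_add, sub_add_cancel, homogeneousComponent_of_mem
      ((mem_homogeneousSubmodule _ _).2 hf), if_pos rfl] at h4
    exact h4
  have hN : ⊤ ≤ N := by
    rintro f -
    rw [← sum_homogeneousComponent f]
    exact Submodule.sum_mem _ fun j _ => hhomN j _ (homogeneousComponent_isHomogeneous j f)
  exact Module.Free.of_basis (Module.Basis.mk hind hN)
end ACI

namespace ACI

lemma height_going {B S : Type} [CommRing B] [CommRing S] [IsNoetherianRing B] [IsNoetherianRing S]
    [Algebra B S]
    [Module.Flat B S] (P : Ideal S) [P.IsPrime] (p : Ideal B)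
    (hp : p = P.comap (algebraMap B S)) : p.height ≤ P.height := by
  have hlo : P.LiesOver p := ⟨hp⟩
  have : p.IsPrime := by rw [hp]; infer_instance
  rw [Ideal.height_eq_height_add_of_liesOver_of_hasGoingDown p P]
  exact le_self_add

lemma height_equiv_le {B S : Type} [CommRing B] [CommRing S] [IsNoetherianRing B] [IsNoetherianRing S]
    (e : B ≃+* S)
    (P : Ideal S) [P.IsPrime] : (P.comap e.toRingHom).height ≤ P.height := by
  letI : Algebra B S := e.toRingHom.toAlgebra
  have : Module.Flat B S :=
    Module.Flat.of_linearEquiv (AlgEquiv.ofRingEquiv (f := e) (fun _ => rfl) :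
      B ≃ₐ[B] S).symm.toLinearEquiv
  exact height_going P _ rfl

lemma height_max {k : Type} [Field k] (t : ℕ) (q : Ideal (MvPolynomial (Fin t) k)) (hq : q.IsPrime)
    (h : ∀ i : Fin t, ∃ s : Polynomial k, s ≠ 0 ∧
      Polynomial.aeval (X i : MvPolynomial (Fin t) k) s ∈ q) : (t : ℕ∞) ≤ q.height := by
  induction t with
  | zero => simp
  | succ t ih =>
    let e := finSuccEquiv k t
    let Q : Ideal (Polynomial (MvPolynomial (Fin t) k)) := q.comap e.symm.toRingEquiv.toRingHom
    have hQp : Q.IsPrime := Ideal.comap_isPrime _ _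
    have hQ : ∀ x, e x ∈ Q ↔ x ∈ q := fun x => by
      show e.symm (e x) ∈ q ↔ _
      rw [e.symm_apply_apply]
    have h1 : Q.height ≤ q.height := height_equiv_le e.symm.toRingEquiv q
    refine le_trans ?_ h1
    let p := Q.comap (Polynomial.C : MvPolynomial (Fin t) k →+* _)
    have hp : p.IsPrime := Ideal.comap_isPrime _ _
    have h2 : (t : ℕ∞) ≤ p.height := by
      refine ih p hp fun i => ?_
      obtain ⟨s, hs0, hs⟩ := h i.succ
      refine ⟨s, hs0, ?_⟩
      rw [← hQ] at hs
      show Polynomial.C _ ∈ Q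
      convert hs using 1
      have e1 : e (Polynomial.aeval (X i.succ) s) = Polynomial.aeval (e (X i.succ)) s :=
        (Polynomial.aeval_algHom_apply e.toAlgHom _ s).symm
      rw [e1, finSuccEquiv_X_succ]
      exact (Polynomial.aeval_algHom_apply
        (IsScalarTower.toAlgHom k (MvPolynomial (Fin t) k) (Polynomial (MvPolynomial (Fin t) k)))
        _ s).symm
    let P0 : Ideal (Polynomial (MvPolynomial (Fin t) k)) := p.map Polynomial.C
    have hP0 : P0.IsPrime := Ideal.isPrime_map_C_of_isPrime
    have h3 : p.height ≤ P0.height := height_going P0 p (comap_map_C p).symm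
    have hlt : P0 < Q := by
      refine lt_of_le_of_ne (Ideal.map_le_iff_le_comap.2 le_rfl) fun heq => ?_
      obtain ⟨s, hs0, hs⟩ := h 0
      rw [← hQ] at hs
      have e1 : e (Polynomial.aeval (X 0) s) = Polynomial.aeval (e (X 0)) s :=
        (Polynomial.aeval_algHom_apply e.toAlgHom _ s).symm
      have e2 : Polynomial.aeval (Polynomial.X : Polynomial (MvPolynomial (Fin t) k)) s
          = s.map (algebraMap k (MvPolynomial (Fin t) k)) := by
        clear hs0 hs e1
        induction s using Polynomial.induction_on' with
        | add p q hp hq => rw [map_add, hp, hq, Polynomial.map_add]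
        | monomial n a =>
          rw [Polynomial.aeval_monomial, Polynomial.map_monomial, ← Polynomial.C_mul_X_pow_eq_monomial]
          rfl
      rw [e1, finSuccEquiv_X_zero, e2, ← heq, Ideal.mem_map_C_iff] at hs
      have := hs s.natDegree
      rw [Polynomial.coeff_map] at this
      refine hp.ne_top (Ideal.eq_top_of_isUnit_mem _ this ?_)
      exact (IsUnit.mk0 _ (by simpa using hs0)).map _
    have h4 := Ideal.height_add_one_le_of_lt_of_isPrime hlt
    calc ((t + 1 : ℕ) : ℕ∞) = (t : ℕ∞) + 1 := by push_cast; rfl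
      _ ≤ P0.height + 1 := by gcongr; exact h2.trans h3
      _ ≤ _ := h4

lemma FD.of_inj {R K M : Type} [CommRing R] [AddCommGroup K] [Module R K] [AddCommGroup M]
    [Module R M] {d : ℕ} (f : K →ₗ[R] M) (hf : Function.Injective f) (hM : FD R d M)
    (hall : ∀ (N : Type) [AddCommGroup N] [Module R N], FD R (d + 1) N) : FD R d K :=
  FD.sub f (LinearMap.range f).mkQ hf (Submodule.mkQ_surjective _) (by
    rw [LinearMap.exact_iff, Submodule.ker_mkQ]) hM (hall _)

lemma FD.inf {R : Type} [CommRing R] {d : ℕ} (I L : Ideal R)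
    (hI : FD R d (R ⧸ I)) (hL : FD R d (R ⧸ L))
    (hall : ∀ (N : Type) [AddCommGroup N] [Module R N], FD R (d + 1) N) :
    FD R d (R ⧸ (I ⊓ L)) := by
  have hk : LinearMap.ker (I.mkQ.prod L.mkQ) = I ⊓ L := by
    rw [LinearMap.ker_prod, Submodule.ker_mkQ, Submodule.ker_mkQ]
  refine FD.of_inj (Submodule.liftQ (I ⊓ L) (I.mkQ.prod L.mkQ) hk.ge) ?_ (FD.prod hI hL) hall
  rw [← LinearMap.ker_eq_bot]
  exact Submodule.ker_liftQ_eq_bot _ _ _ hk.le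

lemma FD.iInf {R : Type} [CommRing R] {d : ℕ} {ι : Type} (s : Finset ι) (I : ι → Ideal R)
    (hI : ∀ i ∈ s, FD R d (R ⧸ I i))
    (hall : ∀ (N : Type) [AddCommGroup N] [Module R N], FD R (d + 1) N) :
    FD R d (R ⧸ (s.inf I)) := by
  classical
  induction s using Finset.induction_on with
  | empty =>
    rw [Finset.inf_empty]
    have : Subsingleton (R ⧸ (⊤ : Ideal R)) := Ideal.Quotient.subsingleton_iff.2 rfl
    exact FD.of_subsingleton d
  | insert a s ha ih =>
    rw [Finset.inf_insert]
    exact FD.inf _ _ (hI a (by simp)) (ih fun i hi => hI i (by simp [hi])) hall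

section
variable {k : Type} [Field k] {n t : ℕ}
  [Algebra (MvPolynomial (Fin t) k) (MvPolynomial (Fin n) k)]
  [Module.Free (MvPolynomial (Fin t) k) (MvPolynomial (Fin n) k)]

/-- Saturation of an ideal with respect to nonzero polynomials in one variable. -/
def sat (K : Ideal (MvPolynomial (Fin t) k)) (i : Fin t) : Ideal (MvPolynomial (Fin t) k) where
  carrier := {a | ∃ s : Polynomial k, s ≠ 0 ∧
    Polynomial.aeval (X i : MvPolynomial (Fin t) k) s * a ∈ K}
  add_mem' := by
    rintro a b ⟨s, hs, ha⟩ ⟨s', hs', hb⟩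
    refine ⟨s * s', mul_ne_zero hs hs', ?_⟩
    rw [map_mul, mul_add]
    refine add_mem ?_ ?_
    · rw [mul_right_comm]; exact K.mul_mem_right _ ha
    · rw [mul_assoc]; exact K.mul_mem_left _ hb
  zero_mem' := ⟨1, one_ne_zero, by rw [mul_zero]; exact K.zero_mem⟩
  smul_mem' := by
    rintro c a ⟨s, hs, ha⟩
    refine ⟨s, hs, ?_⟩
    rw [smul_eq_mul, mul_left_comm]; exact K.mul_mem_left _ ha

lemma fd_sat {t : ℕ} (K : Ideal (MvPolynomial (Fin (t + 1)) k)) (i : Fin (t + 1)) :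
    FD (MvPolynomial (Fin (t + 1)) k) t (MvPolynomial (Fin (t + 1)) k ⧸ sat K i) := by
  refine fd_torsionfree t i _ fun s hs m hm => ?_
  obtain ⟨a, rfl⟩ := Ideal.Quotient.mk_surjective m
  have hm' : Ideal.Quotient.mk (sat K i) (Polynomial.aeval (X i) s * a) = 0 := hm
  rw [Ideal.Quotient.eq_zero_iff_mem] at hm'
  replace hm := hm'
  obtain ⟨s', hs', h⟩ := hm
  rw [Ideal.Quotient.eq_zero_iff_mem]
  exact ⟨s' * s, mul_ne_zero hs' hs, by rwa [map_mul, mul_assoc]⟩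

/-- Quotients by extended ideals whose associated primes have height at most `g`. -/
lemma fd_extended (K : Ideal (MvPolynomial (Fin t) k)) (g : ℕ)
    (hK : ∀ z ∉ K.map (algebraMap (MvPolynomial (Fin t) k) (MvPolynomial (Fin n) k)),
      ∃ p : Ideal (MvPolynomial (Fin n) k), p.IsPrime ∧ p.height ≤ g ∧
        ∀ a, a * z ∈ K.map (algebraMap (MvPolynomial (Fin t) k) (MvPolynomial (Fin n) k)) → a ∈ p) :
    FD (MvPolynomial (Fin n) k) (max g (t - 1)) (MvPolynomial (Fin n) k ⧸
      K.map (algebraMap (MvPolynomial (Fin t) k) (MvPolynomial (Fin n) k))) := by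
  suffices h : FD (MvPolynomial (Fin t) k) (max g (t - 1)) (MvPolynomial (Fin t) k ⧸ K) by
    exact (FD.baseChange h).of_equiv
      (Algebra.TensorProduct.quotIdealMapEquivTensorQuot (MvPolynomial (Fin n) k) K).symm.toLinearEquiv
  rcases le_or_gt t g with htg | htg
  · exact (fd_field t _).mono (by omega)
  obtain ⟨t, rfl⟩ : ∃ t', t = t' + 1 := ⟨t - 1, by omega⟩
  refine FD.mono (d := t) ?_ (by omega)
  have hinf : Finset.univ.inf (sat K) = K := by
    refine le_antisymm ?_ (Finset.le_inf fun i _ a ha => ⟨1, one_ne_zero, by simpa using ha⟩)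
    intro a ha
    simp only [Submodule.mem_finsetInf, Finset.mem_univ, true_implies] at ha
    by_contra hna
    have hna' : algebraMap _ (MvPolynomial (Fin n) k) a ∉
        K.map (algebraMap (MvPolynomial (Fin (t + 1)) k) (MvPolynomial (Fin n) k)) := by
      rwa [← Ideal.mem_comap, Ideal.comap_map_eq_self_of_faithfullyFlat]
    obtain ⟨p, hpp, hpg, hpa⟩ := hK _ hna'
    have h1 := height_max (t + 1) (p.comap (algebraMap (MvPolynomial (Fin (t + 1)) k) _))
      (Ideal.comap_isPrime _ _) (fun i => by
        obtain ⟨s, hs, hsa⟩ := ha i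
        refine ⟨s, hs, ?_⟩
        rw [Ideal.mem_comap]
        refine hpa _ ?_
        rw [← map_mul]
        exact Ideal.mem_map_of_mem _ hsa)
    have h2 := h1.trans (height_going p _ rfl)
    have h3 := h2.trans hpg
    have : t + 1 ≤ g := by exact_mod_cast h3
    omega
  rw [← hinf]
  exact FD.iInf _ _ (fun i _ => fd_sat K i) (fun N _ _ => fd_field (t + 1) N)
end
end ACI

namespace ACI
section Gen
variable {R : Type} [CommRing R]

lemma idealHeight_le {J p : Ideal R} (hp : p.IsPrime) (h : J ≤ p) : idealHeight J ≤ p.height := by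
  let e : {q : Ideal R // q.IsPrime} ≃o PrimeSpectrum R :=
    { toFun := fun q => ⟨q.1, q.2⟩
      invFun := fun q => ⟨q.asIdeal, q.isPrime⟩
      left_inv := fun _ => rfl
      right_inv := fun _ => rfl
      map_rel_iff' := Iff.rfl }
  have h1 : Order.height (⟨p, hp⟩ : {q : Ideal R // q.IsPrime}) = p.height := by
    rw [← Order.height_orderIso e]
    exact (PrimeSpectrum.height_eq_orderHeight (⟨p, hp⟩ : PrimeSpectrum R)).symm
  rw [← h1]
  exact iInf₂_le (f := fun (p : {q : Ideal R // q.IsPrime})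
    (_ : p ∈ {p : {q : Ideal R // q.IsPrime} | J ≤ p.1}) => Order.height p) ⟨p, hp⟩ h

lemma idealHeight_mono {J p : Ideal R} (h : J ≤ p) : idealHeight J ≤ idealHeight p := by
  unfold idealHeight
  exact le_iInf₂ fun q hq => iInf₂_le (f := fun (p : {q : Ideal R // q.IsPrime})
    (_ : p ∈ {p : {q : Ideal R // q.IsPrime} | J ≤ p.1}) => Order.height p) q (le_trans h hq)

/-- Colon ideal. -/
def col (C H : Ideal R) : Ideal R where
  carrier := {a | ∀ h ∈ H, a * h ∈ C}
  add_mem' := fun ha hb h hh => by rw [add_mul]; exact add_mem (ha h hh) (hb h hh)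
  zero_mem' := fun h _ => by rw [zero_mul]; exact C.zero_mem
  smul_mem' := fun c a ha h hh => by
    rw [smul_eq_mul, mul_assoc]; exact C.mul_mem_left _ (ha h hh)

lemma mem_col {C H : Ideal R} {a : R} : a ∈ col C H ↔ ∀ h ∈ H, a * h ∈ C := Iff.rfl

lemma le_col (C H : Ideal R) : C ≤ col C H := fun a ha h _ => C.mul_mem_right _ ha

lemma colon_eq_col (C H : Ideal R) : Submodule.colon C (H : Set R) = col C H := by
  ext a
  rw [Submodule.mem_colon]
  rfl

lemma ses_mul (C L : Ideal R) (f : R) (hL : ∀ a, a ∈ L ↔ f * a ∈ C) {d : ℕ}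
    (h1 : FD R d (R ⧸ L)) (h2 : FD R (d + 1) (R ⧸ C)) :
    FD R (d + 1) (R ⧸ (C ⊔ Ideal.span {f})) := by
  let φ : (R ⧸ L) →ₗ[R] (R ⧸ C) := Submodule.mapQ L C (LinearMap.mulLeft R f)
    (fun a ha => (hL a).1 ha)
  let ψ : (R ⧸ C) →ₗ[R] (R ⧸ (C ⊔ Ideal.span {f})) :=
    Submodule.mapQ C (C ⊔ Ideal.span {f}) LinearMap.id (fun a ha => Ideal.mem_sup_left ha)
  have hφ : ∀ a : R, φ (L.mkQ a) = C.mkQ (f * a) := fun a => rfl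
  have hψ : ∀ a : R, ψ (C.mkQ a) = (C ⊔ Ideal.span {f}).mkQ a := fun a => rfl
  refine FD.quot φ ψ ?_ ?_ ?_ h1 h2
  · rw [injective_iff_map_eq_zero]
    intro z hz
    obtain ⟨a, rfl⟩ := L.mkQ_surjective z
    rw [hφ, Submodule.mkQ_apply, Submodule.Quotient.mk_eq_zero, ← hL] at hz
    rwa [Submodule.mkQ_apply, Submodule.Quotient.mk_eq_zero]
  · intro z
    obtain ⟨a, rfl⟩ := Submodule.mkQ_surjective _ z
    exact ⟨C.mkQ a, rfl⟩
  · intro z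
    obtain ⟨a, rfl⟩ := Submodule.mkQ_surjective _ z
    rw [hψ, Submodule.mkQ_apply, Submodule.Quotient.mk_eq_zero, Submodule.mem_sup]
    constructor
    · rintro ⟨c, hc, w, hw, rfl⟩
      obtain ⟨b, rfl⟩ := Ideal.mem_span_singleton'.1 hw
      refine ⟨L.mkQ b, ?_⟩
      rw [hφ, Submodule.mkQ_apply, Submodule.mkQ_apply, Submodule.Quotient.eq, mul_comm]
      have : b * f - (c + b * f) = -c := by ring
      rw [this]; exact C.neg_mem hc
    · rintro ⟨w, hw⟩
      obtain ⟨b, rfl⟩ := L.mkQ_surjective w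
      rw [hφ, Submodule.mkQ_apply, Submodule.mkQ_apply, Submodule.Quotient.eq] at hw
      refine ⟨-(f * b - a), C.neg_mem hw, f * b, Ideal.mul_mem_right _ _
        (Ideal.mem_span_singleton_self f), by ring⟩

lemma fd_nzd (C : Ideal R) (f : R) (hf : Nzd C f) {d : ℕ} (h : FD R d (R ⧸ C)) :
    FD R (d + 1) (R ⧸ (C ⊔ Ideal.span {f})) :=
  ses_mul C C f (fun a => ⟨fun ha => C.mul_mem_left _ ha, hf a⟩) h (h.mono (Nat.le_succ d))

lemma fd_bot : FD R 0 (R ⧸ (⊥ : Ideal R)) :=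
  FD.of_equiv (Submodule.quotEquivOfEqBot ⊥ rfl).symm (FD.of_flat (M := R) 0)

lemma fd_regL (I : Ideal R) (c : List R) (hc : RegL I c) {d : ℕ} (h : FD R d (R ⧸ I)) :
    FD R (d + c.length) (R ⧸ (I ⊔ Ideal.ofList c)) := by
  induction c generalizing I d with
  | nil =>
    rw [show I ⊔ Ideal.ofList [] = I by simp]
    exact h
  | cons x c ih =>
    have := ih _ hc.2 (fd_nzd I x hc.1 h)
    rw [sup_assoc] at this
    rw [Ideal.ofList_cons, List.length_cons]
    convert this using 1
    omega

lemma mulmap_le [IsNoetherianRing R] (I H : Ideal R) (x y : R) (hx : Nzd I x) (hyH : y ∈ H) :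
    Submodule.map (LinearMap.lsmul R (R ⧸ I) y)
      (Submodule.map I.mkQ (col (I ⊔ Ideal.span {x}) H)) ≤
    Submodule.map (LinearMap.lsmul R (R ⧸ I) x)
      (Submodule.map I.mkQ (col (I ⊔ Ideal.span {y}) H)) := by
  rintro _ ⟨_, ⟨a, ha, rfl⟩, rfl⟩
  obtain ⟨b, hb, hbH⟩ := swap_mul I H x y hx hyH a ha
  refine ⟨I.mkQ b, ⟨b, hbH, rfl⟩, ?_⟩
  rw [LinearMap.lsmul_apply, LinearMap.lsmul_apply, ← map_smul, ← map_smul, eq_comm,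
    Submodule.mkQ_apply, Submodule.mkQ_apply, Submodule.Quotient.eq]
  exact hb

lemma lsmul_inj (I : Ideal R) (x : R) (hx : Nzd I x) :
    Function.Injective (LinearMap.lsmul R (R ⧸ I) x) := by
  rw [injective_iff_map_eq_zero]
  intro z hz
  obtain ⟨a, rfl⟩ := I.mkQ_surjective z
  rw [LinearMap.lsmul_apply, ← map_smul, Submodule.mkQ_apply, Submodule.Quotient.mk_eq_zero] at hz
  rw [Submodule.mkQ_apply, Submodule.Quotient.mk_eq_zero]
  exact hx a hz

lemma swap_fd [IsNoetherianRing R] (I H : Ideal R) (x y : R) (hx : Nzd I x) (hy : Nzd I y) (hxH : x ∈ H) (hyH : y ∈ H)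
    {d : ℕ} (hI : FD R d (R ⧸ I)) (h : FD R (d + 1) (R ⧸ col (I ⊔ Ideal.span {x}) H)) :
    FD R (d + 1) (R ⧸ col (I ⊔ Ideal.span {y}) H) := by
  let Kx : Submodule R (R ⧸ I) := Submodule.map I.mkQ (col (I ⊔ Ideal.span {x}) H)
  let Ky : Submodule R (R ⧸ I) := Submodule.map I.mkQ (col (I ⊔ Ideal.span {y}) H)
  have hle : ∀ z, I ≤ col (I ⊔ Ideal.span {z}) H := fun z => le_sup_left.trans (le_col _ _)
  have hexact : ∀ K : Submodule R (R ⧸ I), Function.Exact K.subtype K.mkQ := fun K => by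
    rw [LinearMap.exact_iff, Submodule.ker_mkQ, Submodule.range_subtype]
  have h1 : FD R d Kx := by
    refine FD.sub Kx.subtype Kx.mkQ Kx.injective_subtype Kx.mkQ_surjective (hexact _) hI ?_
    exact h.of_equiv (Submodule.quotientQuotientEquivQuotient I _ (hle x)).symm
  have heq : Kx.map (LinearMap.lsmul R (R ⧸ I) y) = Ky.map (LinearMap.lsmul R (R ⧸ I) x) :=
    le_antisymm (mulmap_le I H x y hx hyH) (mulmap_le I H y x hy hxH)
  have e : Kx ≃ₗ[R] Ky :=
    (Submodule.equivMapOfInjective _ (lsmul_inj I y hy) Kx).trans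
      ((LinearEquiv.ofEq _ _ heq).trans
        (Submodule.equivMapOfInjective _ (lsmul_inj I x hx) Ky).symm)
  have h2 := h1.of_equiv e
  have h3 := FD.quot Ky.subtype Ky.mkQ Ky.injective_subtype Ky.mkQ_surjective (hexact _) h2
    (hI.mono (Nat.le_succ d))
  exact h3.of_equiv (Submodule.quotientQuotientEquivQuotient I _ (hle y))

lemma link_fd [IsNoetherianRing R] (H : Ideal R) (g d : ℕ) (hgd : g ≤ d) (u v : List R)
    (hu : u.length = g) (hv : v.length = g) (huH : ∀ x ∈ u, x ∈ H) (hvH : ∀ x ∈ v, x ∈ H)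
    (hru : RegL ⊥ u) (hrv : RegL ⊥ v) (h : FD R d (R ⧸ col (Ideal.ofList u) H)) :
    FD R d (R ⧸ col (Ideal.ofList v) H) := by
  have := chain H (fun I => FD R d (R ⧸ col I H)) (fun j I => FD R j (R ⧸ I)) g
    (fun j I x _ hI hx => fd_nzd I x hx hI)
    (fun j I x y hj hI hxH hyH hx hy hQ => by
      obtain ⟨d, rfl⟩ : ∃ d', d = d' + 1 := ⟨d - 1, by omega⟩
      exact swap_fd I H x y hx hy hxH hyH (hI.mono (by omega)) hQ) g 0 ⊥ u v (by omega) fd_bot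
    hu hv huH hvH hru hrv
  beta_reduce at this
  rw [bot_sup_eq, bot_sup_eq] at this
  exact this h

lemma regL_of_forall (I : Ideal R) (rs : List R)
    (h : ∀ i (hi : i < rs.length), ∀ a, rs[i] * a ∈ I ⊔ Ideal.ofList (rs.take i) →
      a ∈ I ⊔ Ideal.ofList (rs.take i)) : RegL I rs := by
  induction rs generalizing I with
  | nil => trivial
  | cons x rs ih =>
    refine ⟨fun a ha => ?_, ih _ fun i hi a ha => ?_⟩
    · have := h 0 (by simp) a
      simpa using this (by simpa using ha)
    · have := h (i + 1) (by simpa using hi) a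
      rw [List.take_succ_cons, Ideal.ofList_cons, ← sup_assoc] at this
      exact this (by simpa using ha)

lemma regL_of_weak (rs : List R) (h : RingTheory.Sequence.IsWeaklyRegular R rs) : RegL ⊥ rs := by
  refine regL_of_forall ⊥ rs fun i hi a ha => ?_
  rw [bot_sup_eq] at ha ⊢
  have h1 := h.regular_mod_prev i hi
  have hI : (Ideal.ofList (rs.take i) • ⊤ : Submodule R R) = Ideal.ofList (rs.take i) := by
    rw [smul_eq_mul, Ideal.mul_top]
  rw [← hI] at ha ⊢
  have : rs[i] • (Submodule.Quotient.mk a : R ⧸ (Ideal.ofList (rs.take i) • ⊤ : Submodule R R)) = 0 := by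
    rw [← Submodule.Quotient.mk_smul, Submodule.Quotient.mk_eq_zero]; exact ha
  have := h1.right_eq_zero_of_smul this
  rwa [Submodule.Quotient.mk_eq_zero] at this

lemma mem_primaryComponent {J p : Ideal R} (hp : p.IsPrime) {b : R}
    (hb : b ∈ primaryComponent J p) : ∃ s, s ∉ p ∧ s * b ∈ J := by
  let L : Ideal R :=
    { carrier := {b | ∃ s, s ∉ p ∧ s * b ∈ J}
      add_mem' := by
        rintro a b ⟨s, hs, ha⟩ ⟨s', hs', hb⟩
        refine ⟨s * s', fun h => (hp.mem_or_mem h).elim hs hs', ?_⟩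
        rw [mul_add]
        refine add_mem ?_ ?_
        · rw [mul_right_comm]; exact J.mul_mem_right _ ha
        · rw [mul_assoc]; exact J.mul_mem_left _ hb
      zero_mem' := ⟨1, fun h => hp.ne_top ((Ideal.eq_top_iff_one _).2 h), by simp⟩
      smul_mem' := by
        rintro c a ⟨s, hs, ha⟩
        refine ⟨s, hs, ?_⟩
        rw [smul_eq_mul, mul_left_comm]; exact J.mul_mem_left _ ha }
  have hle : primaryComponent J p ≤ L := by
    refine iSup₂_le fun s hs b hb => ⟨s, hs, ?_⟩
    rw [mul_comm]
    exact Submodule.mem_colon.1 hb s (Ideal.mem_span_singleton_self s)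
  exact hle hb

lemma le_unmixed (J : Ideal R) : J ≤ unmixedPart J := by
  refine le_iInf₂ fun p hp => ?_
  have h1 : (1 : R) ∉ p := fun h => hp.1.ne_top ((Ideal.eq_top_iff_one _).2 h)
  refine le_trans ?_ (le_iSup₂ (f := fun (s : R) (_ : s ∉ p) =>
    Submodule.colon J (Ideal.span {s} : Ideal R)) 1 h1)
  intro a ha
  exact Submodule.mem_colon.2 fun s _ => J.mul_mem_right _ ha

/-- `C : J = C : J^un`. -/
lemma col_unmixed [IsNoetherianRing R] (hR : CM R) (J : Ideal R) (c : List R) (hc : RegL ⊥ c)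
    (hcJ : Ideal.ofList c ≤ J) (hJ : idealHeight J = (c.length : ℕ∞)) :
    col (Ideal.ofList c) J = col (Ideal.ofList c) (unmixedPart J) := by
  refine le_antisymm (fun a ha b hb => ?_) (fun a ha b hb => ha b (le_unmixed J hb))
  by_contra hab
  obtain ⟨p, hp, hpa⟩ := exists_assoc _ _ hab
  have hJp : J ≤ p := fun j hj => hpa j (by
    have := Ideal.mul_mem_right b _ (ha j hj)
    convert this using 1; ring)
  have h1 : p.height ≤ c.length := hR c hc p hp
  have h2 : idealHeight p = idealHeight J :=
    le_antisymm ((idealHeight_le hp.1 le_rfl).trans (h1.trans hJ.ge)) (idealHeight_mono hJp)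
  have hb' : b ∈ primaryComponent J p := by
    have := (iInf₂_le (f := fun (p : Ideal R) (_ : p ∈ {p : Ideal R | p.IsPrime ∧ J ≤ p ∧
      idealHeight p = idealHeight J}) => primaryComponent J p) p ⟨hp.1, hJp, h2⟩)
    exact this hb
  obtain ⟨s, hs, hsb⟩ := mem_primaryComponent hp.1 hb'
  refine hs (hpa s ?_)
  have := ha _ hsb
  convert this using 1; ring

/-- General position of generators. -/
lemma gens [IsNoetherianRing R] (hR : CM R) (J : Ideal R) (g : ℕ)
    (hJ : ∀ p : Ideal R, p.IsPrime → J ≤ p → (g : ℕ∞) ≤ p.height)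
    (l0 : List R) (hl0 : l0.length = g + 1) (hl0J : Ideal.ofList l0 = J) (j : ℕ) (hj : j ≤ g) :
    ∃ c l : List R, c.length = j ∧ l.length = g + 1 - j ∧ RegL ⊥ c ∧
      Ideal.ofList c ⊔ Ideal.ofList l = J := by
  induction j with
  | zero => exact ⟨[], l0, rfl, hl0, trivial, by simpa using hl0J⟩
  | succ j ih =>
    obtain ⟨c, l, hc, hl, hreg, hJc⟩ := ih (by omega)
    match l, hl with
    | [], hl => simp at hl; omega
    | x :: l, hl =>
    have hfin := assoc_finite (Ideal.ofList c)
    obtain ⟨i, hi, hav⟩ := coset_avoid hfin.toFinset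
      (fun p hp => (hfin.mem_toFinset.1 hp).1) x (Ideal.ofList l) (fun p hp hle => by
        have hp := hfin.mem_toFinset.1 hp
        have h1 := hR c hreg p hp
        have h2 := hJ p hp.1 (by
          rw [← hJc, Ideal.ofList_cons]
          exact sup_le (assoc_le hp) hle)
        have := h2.trans h1
        rw [hc] at this
        have : g ≤ j := by exact_mod_cast this
        omega)
    refine ⟨c ++ [x + i], l, by simp [hc], by simp at hl; omega, ?_, ?_⟩
    · rw [regL_snoc]
      refine ⟨hreg, ?_⟩
      rw [bot_sup_eq]
      exact nzd_of_avoid _ _ fun p hp => hav p (hfin.mem_toFinset.2 hp)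
    · rw [← hJc, ofList_append_single, Ideal.ofList_cons, sup_assoc]
      congr 1
      refine le_antisymm (sup_le ?_ le_sup_right) (sup_le ?_ le_sup_right)
      · rw [Ideal.span_singleton_le_iff_mem]
        exact add_mem (Ideal.mem_sup_left (Ideal.mem_span_singleton_self x))
          (Ideal.mem_sup_right hi)
      · rw [Ideal.span_singleton_le_iff_mem]
        have := sub_mem (Ideal.mem_sup_left (T := Ideal.ofList l)
          (Ideal.mem_span_singleton_self (x + i))) (Ideal.mem_sup_right hi)
        simpa using this
end Gen
end ACI

namespace ACI
section Ext
variable {B S : Type} [CommRing B] [CommRing S] [Algebra B S]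

lemma coord_mem [Module.Free B S] (I : Ideal B) (z : S) (hz : z ∈ I.map (algebraMap B S))
    (e : Module.Free.ChooseBasisIndex B S) :
    (Module.Free.chooseBasis B S).repr z e ∈ I := by
  have hz' : z ∈ (I • ⊤ : Submodule B S) := by
    rw [Ideal.smul_top_eq_map]; exact hz
  refine Submodule.smul_induction_on hz' ?_ ?_
  · intro r hr m _
    rw [map_smul, Finsupp.smul_apply, smul_eq_mul]
    exact I.mul_mem_right _ hr
  · intro x y hx hy
    rw [map_add, Finsupp.add_apply]
    exact add_mem hx hy

lemma mem_of_coord [Module.Free B S] (I : Ideal B) (z : S)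
    (h : ∀ e, (Module.Free.chooseBasis B S).repr z e ∈ I) : z ∈ I.map (algebraMap B S) := by
  rw [← (Module.Free.chooseBasis B S).linearCombination_repr z, Finsupp.linearCombination_apply]
  refine Submodule.sum_mem _ fun e _ => ?_
  dsimp only
  rw [Algebra.smul_def]
  exact Ideal.mul_mem_right _ _ (Ideal.mem_map_of_mem _ (h e))

lemma col_map [Module.Free B S] (C H : Ideal B) :
    col (C.map (algebraMap B S)) (H.map (algebraMap B S)) = (col C H).map (algebraMap B S) := by
  refine le_antisymm (fun z hz => ?_) ?_
  · refine mem_of_coord _ _ fun e h hh => ?_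
    have h1 := coord_mem C _ (hz _ (Ideal.mem_map_of_mem _ hh)) e
    rw [mul_comm, ← Algebra.smul_def, map_smul, Finsupp.smul_apply, smul_eq_mul] at h1
    rwa [mul_comm]
  · rw [Ideal.map_le_iff_le_comap]
    intro a ha
    change algebraMap B S a ∈ col _ _
    have : H.map (algebraMap B S) ≤
        Submodule.comap (LinearMap.mulLeft S (algebraMap B S a)) (C.map (algebraMap B S)) := by
      rw [Ideal.map_le_iff_le_comap]
      intro b hb
      change algebraMap B S a * algebraMap B S b ∈ C.map (algebraMap B S)
      rw [← map_mul]
      exact Ideal.mem_map_of_mem _ (ha b hb)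
    exact fun h hh => this hh

lemma exists_u [IsNoetherianRing S] (hS : CM S) (H : Ideal B) (g : ℕ)
    (hH : ∀ p : Ideal S, p.IsPrime → H.map (algebraMap B S) ≤ p → (g : ℕ∞) ≤ p.height)
    (j : ℕ) (hj : j ≤ g) :
    ∃ u : List B, u.length = j ∧ (∀ x ∈ u, x ∈ H) ∧ RegL ⊥ (u.map (algebraMap B S)) := by
  classical
  induction j with
  | zero => exact ⟨[], rfl, by simp, trivial⟩
  | succ j ih =>
    obtain ⟨u, hu, huH, hreg⟩ := ih (by omega)
    have hfin := assoc_finite (Ideal.ofList (u.map (algebraMap B S)))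
    obtain ⟨i, hi, hav⟩ := coset_avoid
      (hfin.toFinset.image (fun p => p.comap (algebraMap B S)))
      (fun p hp => by
        obtain ⟨q, hq, rfl⟩ := Finset.mem_image.1 hp
        have := (hfin.mem_toFinset.1 hq).1
        exact Ideal.comap_isPrime _ q) 0 H (fun p hp hle => by
        obtain ⟨q, hq, rfl⟩ := Finset.mem_image.1 hp
        have hq := hfin.mem_toFinset.1 hq
        have h1 := hS _ hreg q hq
        have h2 := hH q hq.1 (Ideal.map_le_iff_le_comap.2 (le_sup_right.trans hle))
        have := h2.trans h1
        rw [List.length_map, hu] at this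
        have : g ≤ j := by exact_mod_cast this
        omega)
    refine ⟨u ++ [i], by simp [hu], ?_, ?_⟩
    · intro x hx
      rcases List.mem_append.1 hx with hx | hx
      · exact huH x hx
      · rw [List.mem_singleton.1 hx]; exact hi
    · rw [List.map_append, List.map_singleton, regL_snoc]
      refine ⟨hreg, ?_⟩
      rw [bot_sup_eq]
      refine nzd_of_avoid _ _ fun p hp hip => ?_
      refine hav _ (Finset.mem_image_of_mem _ (hfin.mem_toFinset.2 hp)) ?_
      rw [zero_add]
      exact hip
end Ext

section Main
variable {k : Type} [Field k] {n t : ℕ}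

lemma ext_map [Algebra (MvPolynomial (Fin t) k) (MvPolynomial (Fin n) k)]
    (h : Fin t → MvPolynomial (Fin n) k) (hφ : ∀ a, algebraMap (MvPolynomial (Fin t) k)
      (MvPolynomial (Fin n) k) a = aeval h a) (K : Ideal (MvPolynomial (Fin n) k))
    (hK : extendedFrom K (Algebra.adjoin k (Set.range h))) :
    ∃ L : Ideal (MvPolynomial (Fin t) k),
      L.map (algebraMap (MvPolynomial (Fin t) k) (MvPolynomial (Fin n) k)) = K := by
  obtain ⟨S, hS, rfl⟩ := hK
  refine ⟨Ideal.comap (algebraMap _ _) (Ideal.span S), le_antisymm Ideal.map_comap_le ?_⟩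
  rw [Ideal.span_le]
  intro s hs
  have h1 : s ∈ Algebra.adjoin k (Set.range h) := hS hs
  rw [Algebra.adjoin_range_eq_range_aeval] at h1
  obtain ⟨a, rfl⟩ := h1
  have h2 : (aeval h : MvPolynomial (Fin t) k →ₐ[k] MvPolynomial (Fin n) k).toRingHom a
      = algebraMap (MvPolynomial (Fin t) k) (MvPolynomial (Fin n) k) a := (hφ a).symm
  rw [h2] at hs ⊢
  exact Ideal.mem_map_of_mem _ (Ideal.mem_comap.2 (Ideal.subset_span hs))

lemma degs (h : Fin t → MvPolynomial (Fin n) k)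
    (hhom : ∀ i, ∃ d, (h i).IsHomogeneous d)
    (hreg : RingTheory.Sequence.IsRegular (MvPolynomial (Fin n) k) (List.ofFn h)) (i : Fin t) :
    ∃ d, 1 ≤ d ∧ (h i).IsHomogeneous d := by
  obtain ⟨d, hd⟩ := hhom i
  rcases Nat.eq_zero_or_pos d with rfl | hpos
  · by_cases h0 : h i = 0
    · exact ⟨1, le_rfl, by rw [h0]; exact isHomogeneous_zero _ _ _⟩
    · exfalso
      have hC : h i = C (coeff 0 (h i)) := by
        rw [← totalDegree_eq_zero_iff_eq_C]
        exact (hd.totalDegree h0)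
      have hunit : IsUnit (h i) := by
        rw [hC]
        refine IsUnit.map C (isUnit_iff_ne_zero.2 fun h1 => h0 ?_)
        rw [hC, h1, C_0]
      have htop : Ideal.ofList (List.ofFn h) = ⊤ :=
        Ideal.eq_top_of_isUnit_mem _ (Ideal.subset_span
          (by simp : h i ∈ {x | x ∈ List.ofFn h})) hunit
      apply hreg.top_ne_smul
      rw [htop, smul_eq_mul, Ideal.mul_top]
  · exact ⟨d, hpos, hd⟩

/-- Links of height `g` extended from the subring. -/
lemma fd_link_ext [Algebra (MvPolynomial (Fin t) k) (MvPolynomial (Fin n) k)]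
    [Module.Free (MvPolynomial (Fin t) k) (MvPolynomial (Fin n) k)]
    (g : ℕ) (c : List (MvPolynomial (Fin n) k)) (hc : c.length = g) (hreg : RegL ⊥ c)
    (H : Ideal (MvPolynomial (Fin n) k)) (L : Ideal (MvPolynomial (Fin t) k))
    (hL : L.map (algebraMap (MvPolynomial (Fin t) k) (MvPolynomial (Fin n) k)) =
      col (Ideal.ofList c) H) :
    FD (MvPolynomial (Fin n) k) (max g (t - 1))
      (MvPolynomial (Fin n) k ⧸ col (Ideal.ofList c) H) := by
  rw [← hL]
  refine fd_extended L g ?_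
  rw [hL]
  intro z hz
  rw [mem_col] at hz
  push Not at hz
  obtain ⟨b, hb, hzb⟩ := hz
  obtain ⟨p, hp, hpz⟩ := exists_assoc _ _ hzb
  refine ⟨p, hp.1, ?_, fun a ha => hpz a ?_⟩
  · have := cm_mvPolynomial k n c hreg p hp
    rwa [hc] at this
  · rw [← mul_assoc]; exact ha b hb

theorem main [Algebra (MvPolynomial (Fin t) k) (MvPolynomial (Fin n) k)]
    (J : Ideal (MvPolynomial (Fin n) k)) (g : ℕ)
    (hJht : idealHeight J = (g : ℕ∞))
    (hgen : ∃ s : Finset (MvPolynomial (Fin n) k), s.card = g + 1 ∧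
      Ideal.span (s : Set (MvPolynomial (Fin n) k)) = J)
    (h : Fin t → MvPolynomial (Fin n) k)
    (hφ : ∀ a, algebraMap (MvPolynomial (Fin t) k) (MvPolynomial (Fin n) k) a = aeval h a)
    (hhom : ∀ i, ∃ d, (h i).IsHomogeneous d)
    (hreg : RingTheory.Sequence.IsRegular (MvPolynomial (Fin n) k) (List.ofFn h))
    (hext : extendedFrom (unmixedPart J) (Algebra.adjoin k (Set.range h)) ∨
      ∃ c : List (MvPolynomial (Fin n) k), c.length = g ∧
        (∀ x ∈ c, ∃ d, MvPolynomial.IsHomogeneous x d) ∧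
        RingTheory.Sequence.IsRegular (MvPolynomial (Fin n) k) c ∧
        Ideal.span {x | x ∈ c} ≤ unmixedPart J ∧
        extendedFrom (Submodule.colon (Ideal.span {x | x ∈ c}) (unmixedPart J))
          (Algebra.adjoin k (Set.range h))) :
    pdQuotLE J (max (g + 1) t) := by
  have hCM := cm_mvPolynomial k n
  haveI : Module.Free (MvPolynomial (Fin t) k) (MvPolynomial (Fin n) k) :=
    free_of_reg h hφ (degs h hhom hreg) (regL_of_weak _ hreg.toIsWeaklyRegular)
  have hJp : ∀ p : Ideal (MvPolynomial (Fin n) k), p.IsPrime → J ≤ p → (g : ℕ∞) ≤ p.height :=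
    fun p hp hle => hJht ▸ idealHeight_le hp hle
  -- a link with small projective dimension
  obtain ⟨u, hu, huH, hru, hfd⟩ : ∃ u : List (MvPolynomial (Fin n) k), u.length = g ∧
      (∀ x ∈ u, x ∈ unmixedPart J) ∧ RegL ⊥ u ∧
      FD (MvPolynomial (Fin n) k) (max g (t - 1))
        (MvPolynomial (Fin n) k ⧸ col (Ideal.ofList u) (unmixedPart J)) := by
    rcases hext with hext | ⟨c, hc, -, hcreg, hcH, hcext⟩
    · obtain ⟨H, hH⟩ := ext_map h hφ _ hext
      obtain ⟨u, hu, huH, hru⟩ := exists_u hCM H g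
        (fun p hp hle => hJp p hp ((le_unmixed J).trans (hH ▸ hle))) g le_rfl
      refine ⟨u.map (algebraMap _ _), by simpa using hu, ?_, hru, ?_⟩
      · intro x hx
        obtain ⟨y, hy, rfl⟩ := List.mem_map.1 hx
        rw [← hH]
        exact Ideal.mem_map_of_mem _ (huH y hy)
      · refine fd_link_ext g _ (by simpa using hu) hru _ (col (Ideal.ofList u) H) ?_
        rw [← col_map, hH, Ideal.map_ofList]
    · obtain ⟨L, hL⟩ := ext_map h hφ _ hcext
      have hr := regL_of_weak c hcreg.toIsWeaklyRegular
      refine ⟨c, hc, fun x hx => hcH (Ideal.subset_span hx), hr, ?_⟩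
      refine fd_link_ext g c hc hr _ L ?_
      rw [hL, colon_eq_col]
  obtain ⟨s, hs, hsJ⟩ := hgen
  have hsl : Ideal.ofList s.toList = J := by
    rw [← hsJ, Ideal.ofList]
    congr 1
    ext x
    simp
  obtain ⟨c, l, hc, hl, hrc, hcl⟩ := gens hCM J g hJp s.toList (by simpa using hs) hsl g le_rfl
  obtain ⟨f, rfl⟩ : ∃ f, l = [f] := List.length_eq_one_iff.1 (by omega)
  rw [Ideal.ofList_singleton] at hcl
  have hcJ : Ideal.ofList c ≤ J := hcl ▸ le_sup_left
  have h1 := link_fd (unmixedPart J) g (max g (t - 1)) (le_max_left _ _) u c hu hc huH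
    (fun x hx => le_unmixed J (hcJ (Ideal.subset_span hx))) hru hrc hfd
  rw [← col_unmixed hCM J c hrc hcJ (by rw [hJht, hc])] at h1
  have h2 := fd_regL ⊥ c hrc fd_bot
  rw [bot_sup_eq, zero_add, hc] at h2
  have h3 := ses_mul (Ideal.ofList c) (col (Ideal.ofList c) J) f (fun a => by
    constructor
    · intro ha
      rw [mul_comm]
      exact ha f (hcl ▸ Ideal.mem_sup_right (Ideal.mem_span_singleton_self f))
    · intro ha b hb
      rw [← hcl] at hb
      obtain ⟨x, hx, y, hy, rfl⟩ := Submodule.mem_sup.1 hb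
      obtain ⟨r, rfl⟩ := Ideal.mem_span_singleton'.1 hy
      rw [mul_add]
      refine add_mem (Ideal.mul_mem_left _ _ hx) ?_
      have := Ideal.mul_mem_left _ r ha
      convert this using 1; ring) h1 (h2.mono (by omega))
  rw [hcl] at h3
  exact exists_resolution _ _ (h3.mono (by omega))
end Main
end ACI

theorem statement_2 {k : Type} [Field k] {n : ℕ}
    (J : Ideal (MvPolynomial (Fin n) k)) (g t : ℕ)
    (hJhom : IsHomogeneousIdeal J)
    (hJht : idealHeight J = (g : ℕ∞))
    -- `J` is an almost complete intersection: minimally generated by `g + 1` elements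
    (hgen : ∃ s : Finset (MvPolynomial (Fin n) k), s.card = g + 1 ∧
      Ideal.span (s : Set (MvPolynomial (Fin n) k)) = J)
    (hmin : ¬ ∃ s : Finset (MvPolynomial (Fin n) k), s.card ≤ g ∧
      Ideal.span (s : Set (MvPolynomial (Fin n) k)) = J)
    -- a regular sequence of forms h₁, …, hₜ
    (h : Fin t → MvPolynomial (Fin n) k)
    (hhom : ∀ i, ∃ d, (h i).IsHomogeneous d)
    (hreg : RingTheory.Sequence.IsRegular (MvPolynomial (Fin n) k) (List.ofFn h))
    -- either `J^un` or some ideal linked to `J^un` is extended from `A = k[h₁, …, hₜ]`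
    (hext : extendedFrom (unmixedPart J) (Algebra.adjoin k (Set.range h)) ∨
      ∃ c : List (MvPolynomial (Fin n) k), c.length = g ∧
        (∀ x ∈ c, ∃ d, MvPolynomial.IsHomogeneous x d) ∧
        RingTheory.Sequence.IsRegular (MvPolynomial (Fin n) k) c ∧
        Ideal.span {x | x ∈ c} ≤ unmixedPart J ∧
        extendedFrom (Submodule.colon (Ideal.span {x | x ∈ c}) (unmixedPart J))
          (Algebra.adjoin k (Set.range h))) :
    pdQuotLE J (max (g + 1) t) := by
  letI : Algebra (MvPolynomial (Fin t) k) (MvPolynomial (Fin n) k) :=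
    (aeval h : MvPolynomial (Fin t) k →ₐ[k] MvPolynomial (Fin n) k).toRingHom.toAlgebra
  exact ACI.main J g hJht hgen h (fun _ => rfl) hhom hreg hext

end
end

section
/- Let H and K' be homogeneous ideals of R, let f be a form of degree 3, and let K = (f) + K'. If f ∉ H + K', then the ideal generated by all degree-3 forms of K ∩ H equals the ideal generated by all degree-3 forms of K' ∩ H. If f ∈ H + K', then there exists a form f' of degree 3 such that the ideal generated by all degree-3 forms of K ∩ H equals the ideal generated by all degree-3 forms of (f') + (K' ∩ H). -/
open MvPolynomial Filter CategoryTheory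

noncomputable section

theorem aux_comp_mem {k : Type} [Field k] {N : ℕ} {B : Ideal (MvPolynomial (Fin N) k)}
    (hB : IsHomogeneousIdeal B) {g : MvPolynomial (Fin N) k} (hg : g ∈ B) (n : ℕ) :
    homogeneousComponent n g ∈ B := by
  obtain ⟨S, hS, rfl⟩ := hB
  letI : GradedAlgebra (homogeneousSubmodule (Fin N) k) := MvPolynomial.gradedAlgebra
  have h := Ideal.homogeneous_span (homogeneousSubmodule (Fin N) k) S
    (fun x hx => by
      obtain ⟨d, hd⟩ := hS x hx
      exact ⟨d, (mem_homogeneousSubmodule d x).2 hd⟩)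
  have h2 := h n hg
  rw [← MvPolynomial.decomposition.decompose'_apply]
  exact h2

theorem aux_comp_mul {k : Type} [Field k] {N : ℕ} (a f : MvPolynomial (Fin N) k)
    (n : ℕ) (hf : f.IsHomogeneous n) :
    homogeneousComponent n (a * f) = C (coeff 0 a) * f := by
  induction a using MvPolynomial.induction_on' with
  | monomial d c =>
    have h1 : (monomial d c * f).IsHomogeneous (d.degree + n) :=
      (isHomogeneous_monomial c rfl).mul hf
    rw [homogeneousComponent_of_mem ((mem_homogeneousSubmodule _ _).2 h1), coeff_monomial]
    by_cases hd : d = 0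
    · subst hd
      simp
    · have : d.degree ≠ 0 := by
        simpa [Finsupp.degree_eq_zero_iff] using hd
      rw [if_neg (by omega), if_neg hd]
      simp
  | add p q hp hq => rw [add_mul, map_add, hp, hq, coeff_add, C_add, add_mul]

theorem aux_decomp {k : Type} [Field k] {N : ℕ} {K' : Ideal (MvPolynomial (Fin N) k)}
    (hK' : IsHomogeneousIdeal K') {f g : MvPolynomial (Fin N) k} (hf : f.IsHomogeneous 3)
    (hg : g.IsHomogeneous 3) (hgK : g ∈ Ideal.span {f} ⊔ K') :
    ∃ c : k, ∃ q ∈ K', g = C c * f + q := by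
  obtain ⟨y, hy, z, hz, rfl⟩ := Submodule.mem_sup.1 hgK
  obtain ⟨a, rfl⟩ := Ideal.mem_span_singleton'.1 hy
  refine ⟨coeff 0 a, homogeneousComponent 3 z, aux_comp_mem hK' hz 3, ?_⟩
  have h := homogeneousComponent_of_mem (m := 3) ((mem_homogeneousSubmodule _ _).2 hg)
  rw [if_pos rfl, map_add, aux_comp_mul a f 3 hf] at h
  exact h.symm

theorem statement_3 {k : Type} [Field k] {N : ℕ}
    (H K' : Ideal (MvPolynomial (Fin N) k))
    (hH : IsHomogeneousIdeal H) (hK' : IsHomogeneousIdeal K')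
    (f : MvPolynomial (Fin N) k) (hf : f.IsHomogeneous 3) :
    (f ∉ H ⊔ K' →
      degreePart ((Ideal.span {f} ⊔ K') ⊓ H) 3 = degreePart (K' ⊓ H) 3) ∧
    (f ∈ H ⊔ K' → ∃ f' : MvPolynomial (Fin N) k, f'.IsHomogeneous 3 ∧
      degreePart ((Ideal.span {f} ⊔ K') ⊓ H) 3 =
        degreePart (Ideal.span {f'} ⊔ (K' ⊓ H)) 3) := by
  constructor
  · intro hn
    apply le_antisymm
    · refine Ideal.span_mono ?_
      rintro g ⟨⟨hgK, hgH⟩, hg⟩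
      obtain ⟨c, q, hq, rfl⟩ := aux_decomp hK' hf hg hgK
      refine ⟨⟨?_, hgH⟩, hg⟩
      by_cases hc : c = 0
      · simpa [hc] using hq
      · exfalso
        apply hn
        have h1 : f = C c⁻¹ * (C c * f + q) + (-C c⁻¹) * q := by
          have : (C c⁻¹ : MvPolynomial (Fin N) k) * C c = 1 := by
            rw [← C_mul, inv_mul_cancel₀ hc, C_1]
          linear_combination (-f) * this
        rw [h1]
        exact Submodule.add_mem_sup (Ideal.mul_mem_left _ _ hgH) (Ideal.mul_mem_left _ _ hq)
    · refine Ideal.span_mono ?_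
      rintro g ⟨⟨hgK, hgH⟩, hg⟩
      exact ⟨⟨Ideal.mem_sup_right hgK, hgH⟩, hg⟩
  · intro hm
    obtain ⟨h, hh, q, hq, hhq⟩ := Submodule.mem_sup.1 hm
    have hh3 := aux_comp_mem hH hh 3
    have hq3 := aux_comp_mem hK' hq 3
    have hf3 : f = homogeneousComponent 3 h + homogeneousComponent 3 q := by
      rw [← map_add, hhq, homogeneousComponent_of_mem ((mem_homogeneousSubmodule _ _).2 hf),
        if_pos rfl]
    refine ⟨homogeneousComponent 3 h, homogeneousComponent_isHomogeneous 3 h, ?_⟩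
    generalize homogeneousComponent 3 h = u at *
    generalize homogeneousComponent 3 q = v at *
    apply le_antisymm
    · refine Ideal.span_mono ?_
      rintro g ⟨⟨hgK, hgH⟩, hg⟩
      refine ⟨?_, hg⟩
      obtain ⟨c, r, hr, rfl⟩ := aux_decomp hK' hf hg hgK
      have h1 : C c * f + r = C c * u + (C c * v + r) := by rw [hf3]; ring
      rw [h1] at hgH ⊢
      refine Submodule.add_mem_sup (Ideal.mul_mem_left _ _ (Ideal.mem_span_singleton_self u))
        ⟨K'.add_mem (Ideal.mul_mem_left _ _ hq3) hr, ?_⟩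
      exact (H.add_mem_iff_right (Ideal.mul_mem_left _ _ hh3)).1 hgH
    · refine Ideal.span_mono ?_
      rintro g ⟨hgK, hg⟩
      refine ⟨?_, hg⟩
      refine (sup_le ?_ (inf_le_inf_right H le_sup_right) :
        Ideal.span {u} ⊔ (K' ⊓ H) ≤ (Ideal.span {f} ⊔ K') ⊓ H) hgK
      rw [Ideal.span_singleton_le_iff_mem]
      refine ⟨?_, hh3⟩
      have h1 : u = f + -v := by rw [hf3]; ring
      rw [h1]
      exact Submodule.add_mem_sup (Ideal.mem_span_singleton_self f) (K'.neg_mem hq3)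

end
end

section
/- Let p = (x, y) be a linear prime of R, let H be an ideal with H ⊄ p, and let a, b be forms of equal degree with ht((x, y, a, b)) = 4. If ax + by ∈ p^2 + H, then (p^2 + (ax + by)) ∩ H = (a'x + b'y) + (p^2 ∩ H), where a', b' are forms with deg(a') = deg(b') = deg(a) and (x, y, a', b') = (x, y, a, b). -/
open MvPolynomial Filter CategoryTheory

noncomputable section

theorem aux_proj (k : Type) [Field k] (N : ℕ) :
    ∃ c : ℕ → MvPolynomial (Fin N) k →+ MvPolynomial (Fin N) k,
      (∀ n f, (c n f).IsHomogeneous n) ∧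
      (∀ n f, f.IsHomogeneous n → c n f = f) ∧
      (∀ n f g, g.IsHomogeneous 1 → c (n + 1) (f * g) = c n f * g) ∧
      (∀ J : Ideal (MvPolynomial (Fin N) k), IsHomogeneousIdeal J → ∀ n, ∀ f ∈ J, c n f ∈ J) := by
  classical
  let _ : GradedAlgebra (homogeneousSubmodule (Fin N) k) := MvPolynomial.gradedAlgebra
  refine ⟨fun n => GradedRing.proj (homogeneousSubmodule (Fin N) k) n, ?_, ?_, ?_, ?_⟩
  · intro n f
    exact (DirectSum.decompose (homogeneousSubmodule (Fin N) k) f n).2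
  · intro n f hf
    exact DirectSum.decompose_of_mem_same (homogeneousSubmodule (Fin N) k) hf
  · intro n f g hg
    exact DirectSum.coe_decompose_mul_add_of_right_mem (homogeneousSubmodule (Fin N) k) hg
  · rintro J ⟨S, hS, rfl⟩ n f hf
    exact Ideal.homogeneous_span (homogeneousSubmodule (Fin N) k) S
      (fun g hg => hS g hg) n hf

theorem statement_4 {k : Type} [Field k] {N : ℕ}
    (x y : MvPolynomial (Fin N) k)
    (hx : x.IsHomogeneous 1) (hy : y.IsHomogeneous 1)
    (hp : (Ideal.span {x, y}).IsPrime)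
    (H : Ideal (MvPolynomial (Fin N) k)) (hHhom : IsHomogeneousIdeal H)
    (hH : ¬ H ≤ Ideal.span {x, y})
    (a b : MvPolynomial (Fin N) k) (d : ℕ)
    (ha : a.IsHomogeneous d) (hb : b.IsHomogeneous d)
    (hht : idealHeight (Ideal.span {x, y, a, b}) = 4)
    (hmem : a * x + b * y ∈ Ideal.span {x, y} ^ 2 ⊔ H) :
    ∃ a' b' : MvPolynomial (Fin N) k, a'.IsHomogeneous d ∧ b'.IsHomogeneous d ∧
      Ideal.span {x, y, a', b'} = Ideal.span {x, y, a, b} ∧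
      (Ideal.span {x, y} ^ 2 ⊔ Ideal.span {a * x + b * y}) ⊓ H =
        Ideal.span {a' * x + b' * y} ⊔ (Ideal.span {x, y} ^ 2 ⊓ H) := by
  obtain ⟨c, hc1, hc2, hc3, hc4⟩ := aux_proj k N
  obtain ⟨q, hq, h, hh, hqh⟩ := Submodule.mem_sup.1 hmem
  obtain ⟨u, hu, v, hv, huv⟩ : ∃ u ∈ Ideal.span {x, y}, ∃ v ∈ Ideal.span {x, y},
      u * x + v * y = q := by
    rw [pow_two] at hq
    clear hqh
    refine Submodule.mul_induction_on hq ?_ ?_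
    · intro m hm n hn
      obtain ⟨s, t, rfl⟩ := Ideal.mem_span_pair.1 hn
      exact ⟨m * s, Ideal.mul_mem_right _ _ hm, m * t, Ideal.mul_mem_right _ _ hm, by
        ring⟩
    · rintro m n ⟨u1, hu1, v1, hv1, rfl⟩ ⟨u2, hu2, v2, hv2, rfl⟩
      exact ⟨u1 + u2, Ideal.add_mem _ hu1 hu2, v1 + v2, Ideal.add_mem _ hv1 hv2, by ring⟩
  have hpH : IsHomogeneousIdeal (Ideal.span {x, y}) :=
    ⟨{x, y}, by rintro g (rfl | rfl); exacts [⟨1, hx⟩, ⟨1, hy⟩], rfl⟩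
  have hu' := hc4 _ hpH d u hu
  have hv' := hc4 _ hpH d v hv
  have hh' := hc4 _ hHhom (d + 1) h hh
  have key : c d u * x + c d v * y + c (d + 1) h = a * x + b * y := by
    have e := congrArg (c (d + 1)) hqh
    rw [← huv] at e
    simp only [map_add, hc3 _ _ _ hx, hc3 _ _ _ hy, hc2 _ _ ha, hc2 _ _ hb] at e
    exact e
  have hle : ∀ w z : MvPolynomial (Fin N) k, Ideal.span {x, y} ≤ Ideal.span {x, y, w, z} :=
    fun w z => Ideal.span_mono (by intro t; simp; tauto)
  have hspan : ∀ w z w' z' : MvPolynomial (Fin N) k, w' - w ∈ Ideal.span {x, y} →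
      z' - z ∈ Ideal.span {x, y} → Ideal.span {x, y, w', z'} ≤ Ideal.span {x, y, w, z} := by
    intro w z w' z' h1 h2
    rw [Ideal.span_le]
    rintro t (rfl | rfl | rfl | rfl)
    · exact Ideal.subset_span (by simp)
    · exact Ideal.subset_span (by simp)
    · have := Ideal.add_mem _ (hle w z h1)
        (Ideal.subset_span (by simp) : w ∈ Ideal.span {x, y, w, z})
      simpa using this
    · have := Ideal.add_mem _ (hle w z h2)
        (Ideal.subset_span (by simp) : z ∈ Ideal.span {x, y, w, z})
      simpa using this
  have hab : (a - c d u) * x + (b - c d v) * y = c (d + 1) h := by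
    linear_combination -key
  have hq' : c d u * x + c d v * y ∈ Ideal.span {x, y} ^ 2 := by
    rw [pow_two]
    exact Ideal.add_mem _ (Ideal.mul_mem_mul hu' (Ideal.subset_span (by simp)))
      (Ideal.mul_mem_mul hv' (Ideal.subset_span (by simp)))
  refine ⟨a - c d u, b - c d v, ha.sub (hc1 _ _), hb.sub (hc1 _ _), le_antisymm ?_ ?_, ?_⟩
  · apply hspan
    · simpa using hu'
    · simpa using hv'
  · apply hspan
    · simpa using hu'
    · simpa using hv'
  · rw [hab]
    have hsup : Ideal.span {x, y} ^ 2 ⊔ Ideal.span {a * x + b * y} =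
        Ideal.span {c (d + 1) h} ⊔ Ideal.span {x, y} ^ 2 := by
      apply le_antisymm
      · refine sup_le le_sup_right ?_
        rw [Ideal.span_singleton_le_iff_mem, ← key,
          add_comm (c d u * x + c d v * y)]
        exact Submodule.add_mem_sup (Ideal.mem_span_singleton_self _) hq'
      · refine sup_le ?_ le_sup_left
        rw [Ideal.span_singleton_le_iff_mem]
        have : c (d + 1) h = -(c d u * x + c d v * y) + (a * x + b * y) := by
          linear_combination key
        rw [this]
        exact Submodule.add_mem_sup (neg_mem hq') (Ideal.mem_span_singleton_self _)
    rw [hsup]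
    exact (sup_inf_assoc_of_le _ ((Ideal.span_singleton_le_iff_mem _).2 hh')).symm ▸ rfl

end
end
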